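/- arXiv:1710.04310 — 6 statements merged into one kernel-verified Lean document; each statement's English description precedes it below -/
import Mathlib

section
/- Let f := (z₁ − 2)² − (z₂ − 3)²(z₃ − 5) ∈ ℂ[z₁,z₂,z₃]. For generic (a₁, a₂, a₃, b, u₁, u₂, u₃, u₄) ∈ ℂ⁸, writing ℓ(z) := a₁z₁ + a₂z₂ + a₃z₃ + b, the set {z ∈ (ℂ*)³ : f(z) = 0, ℓ(z) ≠ 0, and there exists λ ∈ ℂ with u_i/z_i + u₄·a_i/ℓ(z) = λ·(∂f/∂z_i)(z) for i = 1,2,3} has exactly 10 elements. (The first removal ML degree of the shifted Whitney umbrella is r₁ = 10.) -/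
open MvPolynomial

/-- The shifted Whitney umbrella `(z₁ − 2)² − (z₂ − 3)²(z₃ − 5)`. -/
noncomputable def umbrella : MvPolynomial (Fin 3) ℂ :=
  (X 0 - 2) ^ 2 - (X 1 - 3) ^ 2 * (X 2 - 5)

/-- A property of points of `ℂ⁸` that holds off the zero locus of a nonzero polynomial. -/
def HoldsGenerically (P : (Fin 8 → ℂ) → Prop) : Prop :=
  ∃ g : MvPolynomial (Fin 8) ℂ, g ≠ 0 ∧ ∀ w, eval w g ≠ 0 → P w

namespace HoldsGenerically

lemma and {P Q : (Fin 8 → ℂ) → Prop} (hP : HoldsGenerically P) (hQ : HoldsGenerically Q) :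
    HoldsGenerically fun w => P w ∧ Q w := by
  obtain ⟨g, hg, hgP⟩ := hP
  obtain ⟨h, hh, hhQ⟩ := hQ
  refine ⟨g * h, mul_ne_zero hg hh, fun w hw => ?_⟩
  rw [map_mul] at hw
  exact ⟨hgP w (left_ne_zero_of_mul hw), hhQ w (right_ne_zero_of_mul hw)⟩

lemma mono {P Q : (Fin 8 → ℂ) → Prop} (hP : HoldsGenerically P) (h : ∀ w, P w → Q w) :
    HoldsGenerically Q :=
  let ⟨g, hg, hgP⟩ := hP
  ⟨g, hg, fun w hw => h w (hgP w hw)⟩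

lemma eval_ne_zero (g : MvPolynomial (Fin 8) ℂ) (w₀ : Fin 8 → ℂ) (h : eval w₀ g ≠ 0) :
    HoldsGenerically fun w => eval w g ≠ 0 :=
  ⟨g, fun hg => h (by simp [hg]), fun _ hw => hw⟩

/-- Two polynomials with coefficients depending polynomially on `w` are coprime for generic `w`
as soon as they are coprime at one point where the first one does not drop degree. -/
lemma isCoprime {m : ℕ} (hm : m ≠ 0) (F G : Polynomial (MvPolynomial (Fin 8) ℂ))
    (hF : F.natDegree ≤ m) (w₀ : Fin 8 → ℂ) (hdeg : (F.map (eval w₀)).natDegree = m)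
    (hcop : IsCoprime (F.map (eval w₀)) (G.map (eval w₀))) :
    HoldsGenerically fun w =>
      IsCoprime (F.map (eval w)) (G.map (eval w)) ∧ (F.map (eval w)).natDegree = m := by
  have hlead : (F.map (eval w₀)).coeff m ≠ 0 := by
    rw [← hdeg]
    refine Polynomial.leadingCoeff_ne_zero.2 fun h => hm ?_
    rw [← hdeg, h, Polynomial.natDegree_zero]
  have hres : eval w₀ (F.resultant G m G.natDegree) ≠ 0 := by
    obtain ⟨k, hk⟩ := Nat.exists_eq_add_of_le (Polynomial.natDegree_map_le (f := eval w₀) (p := G))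
    rw [← Polynomial.resultant_map_map, hk, Polynomial.resultant_add_right_deg _ _ _ _ _ le_rfl]
    refine mul_ne_zero (pow_ne_zero _ hlead) ?_
    have := Polynomial.resultant_ne_zero _ _ hcop
    rwa [hdeg] at this
  refine ((eval_ne_zero _ w₀ hres).and
    (eval_ne_zero (F.coeff m) w₀ (by rwa [← Polynomial.coeff_map]))).mono fun w hw => ⟨?_, ?_⟩
  · obtain ⟨p, q, -, -, hpq⟩ :=
      Polynomial.exists_mul_add_mul_eq_C_resultant F G hF le_rfl (Or.inl hm)
    have h := congrArg (Polynomial.map (eval w)) hpq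
    simp only [Polynomial.map_add, Polynomial.map_mul, Polynomial.map_C] at h
    refine ⟨Polynomial.C (eval w (F.resultant G m G.natDegree))⁻¹ * p.map (eval w),
      Polynomial.C (eval w (F.resultant G m G.natDegree))⁻¹ * q.map (eval w), ?_⟩
    calc _ = Polynomial.C (eval w (F.resultant G m G.natDegree))⁻¹ *
          (F.map (eval w) * p.map (eval w) + G.map (eval w) * q.map (eval w)) := by ring
      _ = 1 := by rw [h, ← Polynomial.C_mul, inv_mul_cancel₀ hw.1, Polynomial.C_1]
  · refine le_antisymm (Polynomial.natDegree_map_le.trans hF) ?_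
    exact Polynomial.le_natDegree_of_ne_zero (by simpa using hw.2)

end HoldsGenerically

namespace Polynomial.Umbrella

variable {A B : Type*} [CommRing A] [CommRing B]

/-- The coefficient of `s` in the linear form at `(2 + s * t, 3 + s, 5 + t ^ 2)`, as a polynomial
in `t`. -/
noncomputable def slope (w : Fin 8 → A) : A[X] := C (w 0) * X + C (w 1)

/-- The constant term in `s` of the pulled back linear form. -/
noncomputable def base (w : Fin 8 → A) : A[X] :=
  C (w 2) * X ^ 2 + (2 * C (w 0) + 3 * C (w 1) + 5 * C (w 2) + C (w 3))

/-- The coefficient of `s ^ 2` in the critical equation `critS`. -/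
noncomputable def p₂ (w : Fin 8 → A) : A[X] :=
  C (w 4 + w 5 + w 7) * X * slope w

/-- The coefficient of `s` in the critical equation `critS`. -/
noncomputable def p₁ (w : Fin 8 → A) : A[X] :=
  C (w 4) * X * (3 * slope w + base w) + C (w 5) * (2 * slope w + X * base w)
    + C (w 7) * slope w * (2 + 3 * X)

/-- The constant term in `s` of the critical equation `critS`. -/
noncomputable def p₀ (w : Fin 8 → A) : A[X] :=
  3 * C (w 4) * X * base w + 2 * C (w 5) * base w + 6 * C (w 7) * slope w

/-- The coefficient of `s ^ 2` in the critical equation `critT`. -/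
noncomputable def q₂ (w : Fin 8 → A) : A[X] :=
  C (w 4) * (5 + X ^ 2) * slope w + 2 * C (w 6) * X ^ 2 * slope w
    + C (w 7 * w 0) * X * (5 + X ^ 2)

/-- The coefficient of `s` in the critical equation `critT`. -/
noncomputable def q₁ (w : Fin 8 → A) : A[X] :=
  C (w 4) * (5 + X ^ 2) * base w + 2 * C (w 6) * X * (2 * slope w + X * base w)
    + 2 * C (w 7) * (5 + X ^ 2) * (C (w 0) + C (w 2) * X ^ 2)

/-- The cofactor of `4 * X` in `q₀`. -/
noncomputable def r₀ (w : Fin 8 → A) : A[X] :=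
  C (w 6) * base w + C (w 7 * w 2) * (5 + X ^ 2)

/-- The constant term in `s` of the critical equation `critT`. -/
noncomputable def q₀ (w : Fin 8 → A) : A[X] := 4 * X * r₀ w

/-- The coefficient of `s` in the combination of the critical equations that is linear in `s`. -/
noncomputable def elimD (w : Fin 8 → A) : A[X] := p₁ w * q₂ w - p₂ w * q₁ w

/-- The constant term in the combination of the critical equations that is linear in `s`. -/
noncomputable def elimN (w : Fin 8 → A) : A[X] := p₀ w * q₂ w - p₂ w * q₀ w

/-- The minor of the critical equations on the coefficients of `s` and `1`. -/
noncomputable def elimM (w : Fin 8 → A) : A[X] := p₀ w * q₁ w - p₁ w * q₀ w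

/-- The resultant of the critical equations with respect to `s`, up to sign. -/
noncomputable def elimR (w : Fin 8 → A) : A[X] := elimN w ^ 2 - elimD w * elimM w

/-- The factor of `elimR` coming from the curve `2 + s * t = 0`, where the cleared equations
have extraneous solutions. -/
noncomputable def elimK (w : Fin 8 → A) : A[X] :=
  C (w 2) * X ^ 3 + (3 * C (w 1) + 5 * C (w 2) + C (w 3)) * X - 2 * C (w 1)

lemma slope_map (φ : A →+* B) (w : Fin 8 → A) : (slope w).map φ = slope (φ ∘ w) := by
  simp [slope]

lemma base_map (φ : A →+* B) (w : Fin 8 → A) : (base w).map φ = base (φ ∘ w) := by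
  simp [base]

lemma p₀_map (φ : A →+* B) (w : Fin 8 → A) : (p₀ w).map φ = p₀ (φ ∘ w) := by
  simp [p₀, slope_map, base_map]

lemma r₀_map (φ : A →+* B) (w : Fin 8 → A) : (r₀ w).map φ = r₀ (φ ∘ w) := by
  simp [r₀, base_map]

lemma elimK_map (φ : A →+* B) (w : Fin 8 → A) : (elimK w).map φ = elimK (φ ∘ w) := by
  simp [elimK]

lemma elimD_map (φ : A →+* B) (w : Fin 8 → A) : (elimD w).map φ = elimD (φ ∘ w) := by
  simp [elimD, p₁, p₂, q₁, q₂, slope_map, base_map]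

lemma elimN_map (φ : A →+* B) (w : Fin 8 → A) : (elimN w).map φ = elimN (φ ∘ w) := by
  simp [elimN, p₀_map, p₂, q₀, q₂, r₀_map, slope_map]

lemma elimM_map (φ : A →+* B) (w : Fin 8 → A) : (elimM w).map φ = elimM (φ ∘ w) := by
  simp [elimM, p₀_map, p₁, q₀, q₁, r₀_map, slope_map, base_map]

lemma elimR_map (φ : A →+* B) (w : Fin 8 → A) : (elimR w).map φ = elimR (φ ∘ w) := by
  simp [elimR, elimN_map, elimM_map, elimD_map]

lemma slope_natDegree_le (w : Fin 8 → A) : (slope w).natDegree ≤ 1 := by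
  unfold slope; compute_degree

lemma base_natDegree_le (w : Fin 8 → A) : (base w).natDegree ≤ 2 := by
  unfold base; compute_degree

lemma r₀_natDegree_le (w : Fin 8 → A) : (r₀ w).natDegree ≤ 2 := by
  unfold r₀ base; compute_degree

lemma elimK_natDegree_le (w : Fin 8 → A) : (elimK w).natDegree ≤ 3 := by
  unfold elimK; compute_degree

lemma elimD_natDegree_le (w : Fin 8 → A) : (elimD w).natDegree ≤ 6 := by
  unfold elimD p₁ p₂ q₁ q₂ slope base; compute_degree

lemma elimN_natDegree_le (w : Fin 8 → A) : (elimN w).natDegree ≤ 6 := by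
  unfold elimN p₀ p₂ q₀ q₂ r₀ slope base; compute_degree

lemma elimM_natDegree_le (w : Fin 8 → A) : (elimM w).natDegree ≤ 7 := by
  unfold elimM p₀ p₁ q₀ q₁ r₀ slope base; compute_degree

lemma elimR_natDegree_le (w : Fin 8 → A) : (elimR w).natDegree ≤ 13 := by
  have hN := elimN_natDegree_le w
  have hD := elimD_natDegree_le w
  have hM := elimM_natDegree_le w
  refine Polynomial.natDegree_sub_le_of_le (m := 12) (n := 13) ?_ ?_ |>.trans (by norm_num)
  · exact Polynomial.natDegree_pow_le_of_le 2 hN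
  · exact Polynomial.natDegree_mul_le_of_le hD hM

lemma isCoprime_of_mul_add_mul_eq_C {K : Type*} [Field K] {f g u v : K[X]} {c : K} (hc : c ≠ 0)
    (h : u * f + v * g = C c) : IsCoprime f g := by
  refine ⟨C c⁻¹ * u, C c⁻¹ * v, ?_⟩
  calc C c⁻¹ * u * f + C c⁻¹ * v * g = C c⁻¹ * (u * f + v * g) := by ring
    _ = 1 := by rw [h, ← C_mul, inv_mul_cancel₀ hc, C_1]

lemma elimD_at : elimD (![1, 1, -1, 0, 1, -1, 1, -1] : Fin 8 → ℂ) =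
      -20 - 30 * X - 18 * X ^ 2 - 9 * X ^ 3 - X ^ 4 - X ^ 5 - X ^ 6 := by
  simp [elimD, p₁, p₂, q₁, q₂, slope, base]
  ring

lemma elimN_at : elimN (![1, 1, -1, 0, 1, -1, 1, -1] : Fin 8 → ℂ) =
      -30 - 30 * X + 12 * X ^ 2 - 25 * X ^ 3 - 6 * X ^ 4 - 5 * X ^ 5 - 6 * X ^ 6 := by
  simp [elimN, p₀, p₂, q₀, q₂, r₀, slope, base]
  ring

lemma elimR_at : elimR (![1, 2, -1, 0, 1, 1, -1, -1] : Fin 8 → ℂ) =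
      3600 - 2100 * X + 960 * X ^ 2 + 4127 * X ^ 3 + 2772 * X ^ 4 + 753 * X ^ 5
      - 48 * X ^ 6 + 130 * X ^ 7 + 476 * X ^ 8 - 54 * X ^ 9 - 216 * X ^ 10
      - 49 * X ^ 11 + 8 * X ^ 12 + 9 * X ^ 13 := by
  simp [elimR, elimD, elimN, elimM, p₀, p₁, p₂, q₀, q₁, q₂, r₀, slope, base]
  rw [show (C 2 : ℂ[X]) = 2 from map_ofNat C 2]
  ring

lemma derivative_elimR_at :
    derivative (elimR (![1, 2, -1, 0, 1, 1, -1, -1] : Fin 8 → ℂ)) =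
      -2100 + 1920 * X + 12381 * X ^ 2 + 11088 * X ^ 3 + 3765 * X ^ 4 - 288 * X ^ 5
      + 910 * X ^ 6 + 3808 * X ^ 7 - 486 * X ^ 8 - 2160 * X ^ 9 - 539 * X ^ 10
      + 96 * X ^ 11 + 117 * X ^ 12 := by
  rw [elimR_at]
  simp only [derivative_add, derivative_sub, derivative_mul, derivative_X_pow, derivative_X,
    derivative_ofNat, map_natCast]
  norm_num
  ring

lemma isCoprime_elimD_elimN_at :
    IsCoprime (elimD (![1, 1, -1, 0, 1, -1, 1, -1] : Fin 8 → ℂ))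
      (elimN ![1, 1, -1, 0, 1, -1, 1, -1]) := by
  rw [elimD_at, elimN_at]
  refine isCoprime_of_mul_add_mul_eq_C (c := 20580) (by norm_num)
    (u := -1872 + 1638 * X - 1218 * X ^ 2 + 223 * X ^ 3 - 121 * X ^ 4 - 138 * X ^ 5)
    (v := 562 + 218 * X + 304 * X ^ 2 - 37 * X ^ 3 + 24 * X ^ 4 + 23 * X ^ 5) ?_
  rw [map_ofNat]
  ring

lemma separable_elimR_at :
    (elimR (![1, 2, -1, 0, 1, 1, -1, -1] : Fin 8 → ℂ)).Separable := by
  rw [Separable, derivative_elimR_at, elimR_at]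
  refine isCoprime_of_mul_add_mul_eq_C (c := 131385319228524136336646400) (by norm_num)
    (u := 34652900297517981352944 + 16590803782075302758922 * X
      + 12793532930650541384745 * X ^ 2 + 5754944548136132861793 * X ^ 3
      + 6422174266000334140980 * X ^ 4 + 4335152851208075496642 * X ^ 5
      - 729084966850396766834 * X ^ 6 - 3282829553608234265860 * X ^ 7
      - 2008700127760067684476 * X ^ 8 - 126559343660006438476 * X ^ 9
      + 189041539331052312753 * X ^ 10 + 83406875603769269955 * X ^ 11)
    (v := -3159465789266382602880 - 9100176821289583574568 * X
      - 5765176447705718180598 * X ^ 2 - 2847386808473343979787 * X ^ 3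
      - 856885385274137136323 * X ^ 4 - 784880270354648157170 * X ^ 5
      - 555913991009807933384 * X ^ 6 + 7217723765762115636 * X ^ 7
      + 326207847307697676814 * X ^ 8 + 196985586241528529566 * X ^ 9
      + 14475000650069828218 * X ^ 10 - 14980351812336143821 * X ^ 11
      - 6415913507982251535 * X ^ 12) ?_
  rw [map_ofNat]
  ring

/-- The restriction of the pulled back linear form to the line `s = -3`. -/
noncomputable def lineRestriction (w : Fin 8 → A) : A[X] := base w - 3 * slope w

/-- Up to the factor `5 + X ^ 2`, the derivative in `t` of the linear form on `s = -3`. -/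
noncomputable def lineTangency (w : Fin 8 → A) : A[X] :=
  (2 * C (w 2) * X - 3 * C (w 0)) * (5 + X ^ 2)

lemma lineRestriction_map (φ : A →+* B) (w : Fin 8 → A) :
    (lineRestriction w).map φ = lineRestriction (φ ∘ w) := by
  simp [lineRestriction, slope_map, base_map]

lemma lineTangency_map (φ : A →+* B) (w : Fin 8 → A) :
    (lineTangency w).map φ = lineTangency (φ ∘ w) := by
  simp [lineTangency]

lemma lineRestriction_natDegree_le (w : Fin 8 → A) : (lineRestriction w).natDegree ≤ 2 := by
  unfold lineRestriction base slope; compute_degree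

/-- The genericity conditions under which the critical points can be counted by elimination. -/
structure IsGeneric (w : Fin 8 → ℂ) : Prop where
  natDegree_elimR : (elimR w).natDegree = 13
  separable_elimR : (elimR w).Separable
  isCoprime_elimD_elimN : IsCoprime (elimD w) (elimN w)
  natDegree_elimK : (elimK w).natDegree = 3
  separable_elimK : (elimK w).Separable
  isCoprime_slope_base : IsCoprime (slope w) (base w)
  isCoprime_line : IsCoprime (lineRestriction w) (lineTangency w)
  isCoprime_r₀_p₀ : IsCoprime (r₀ w) (p₀ w)
  w1_ne : w 1 ≠ 0
  w4_ne : w 4 ≠ 0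
  w5_ne : w 5 ≠ 0
  w6_ne : w 6 ≠ 0
  w7_ne : w 7 ≠ 0
  sing_ne : 3 * w 4 * w 1 - 2 * w 5 * w 0 ≠ 0
  origin_ne : w 5 * (2 * w 0 + 3 * w 1 + 5 * w 2 + w 3) + 3 * w 7 * w 1 ≠ 0

lemma eval_comp_X (w : Fin 8 → ℂ) :
    (MvPolynomial.eval w : MvPolynomial (Fin 8) ℂ → ℂ) ∘ MvPolynomial.X = w := by
  ext; simp

lemma holdsGenerically_elimR :
    HoldsGenerically fun w => (elimR w).Separable ∧ (elimR w).natDegree = 13 := by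
  refine (HoldsGenerically.isCoprime (m := 13) (by norm_num) (elimR MvPolynomial.X)
    (derivative (elimR MvPolynomial.X)) (elimR_natDegree_le _)
    ![1, 2, -1, 0, 1, 1, -1, -1] ?_ ?_).mono fun w hw => ?_
  · rw [elimR_map, eval_comp_X, elimR_at]
    compute_degree!
  · rw [← derivative_map, elimR_map, eval_comp_X]
    exact separable_elimR_at
  · rwa [← derivative_map, elimR_map, eval_comp_X] at hw

lemma holdsGenerically_elimD :
    HoldsGenerically fun w => IsCoprime (elimD w) (elimN w) := by
  refine (HoldsGenerically.isCoprime (m := 6) (by norm_num) (elimD MvPolynomial.X)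
    (elimN MvPolynomial.X) (elimD_natDegree_le _)
    ![1, 1, -1, 0, 1, -1, 1, -1] ?_ ?_).mono fun w hw => ?_
  · rw [elimD_map, eval_comp_X, elimD_at]
    compute_degree!
  · rw [elimD_map, elimN_map, eval_comp_X]
    exact isCoprime_elimD_elimN_at
  · rw [elimD_map, elimN_map, eval_comp_X] at hw
    exact hw.1

lemma holdsGenerically_elimK :
    HoldsGenerically fun w => (elimK w).Separable ∧ (elimK w).natDegree = 3 := by
  have h : elimK (![0, 1, 1, -8, 0, 0, 0, 0] : Fin 8 → ℂ) = X ^ 3 - 2 := by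
    simp [elimK]
    rw [map_ofNat]
    ring
  refine (HoldsGenerically.isCoprime (m := 3) (by norm_num) (elimK MvPolynomial.X)
    (derivative (elimK MvPolynomial.X)) (elimK_natDegree_le _)
    ![0, 1, 1, -8, 0, 0, 0, 0] ?_ ?_).mono fun w hw => ?_
  · rw [elimK_map, eval_comp_X, h]
    compute_degree!
  · rw [← derivative_map, elimK_map, eval_comp_X, h]
    refine isCoprime_of_mul_add_mul_eq_C (c := 6) (by norm_num) (u := -3) (v := X) ?_
    simp only [derivative_sub, derivative_X_pow, derivative_ofNat, map_natCast, map_ofNat]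
    norm_num
    ring
  · rwa [← derivative_map, elimK_map, eval_comp_X] at hw

lemma holdsGenerically_slope :
    HoldsGenerically fun w => IsCoprime (slope w) (base w) := by
  refine (HoldsGenerically.isCoprime (m := 1) (by norm_num) (slope MvPolynomial.X)
    (base MvPolynomial.X) (slope_natDegree_le _)
    ![1, 0, 0, -1, 0, 0, 0, 0] ?_ ?_).mono fun w hw => ?_
  · rw [slope_map, eval_comp_X]
    simp [slope]
  · rw [slope_map, base_map, eval_comp_X]
    refine isCoprime_of_mul_add_mul_eq_C (c := 1) (by norm_num) (u := 0) (v := 1) ?_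
    simp [base]
    ring
  · rw [slope_map, base_map, eval_comp_X] at hw
    exact hw.1

lemma holdsGenerically_line :
    HoldsGenerically fun w => IsCoprime (lineRestriction w) (lineTangency w) := by
  have h : lineRestriction (![0, 0, 1, -4, 0, 0, 0, 0] : Fin 8 → ℂ) = X ^ 2 + 1 := by
    simp [lineRestriction, base, slope]
    rw [map_ofNat]
    ring
  refine (HoldsGenerically.isCoprime (m := 2) (by norm_num) (lineRestriction MvPolynomial.X)
    (lineTangency MvPolynomial.X) (lineRestriction_natDegree_le _)
    ![0, 0, 1, -4, 0, 0, 0, 0] ?_ ?_).mono fun w hw => ?_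
  · rw [lineRestriction_map, eval_comp_X, h]
    compute_degree!
  · rw [lineRestriction_map, lineTangency_map, eval_comp_X, h]
    refine isCoprime_of_mul_add_mul_eq_C (c := 8) (by norm_num) (u := 2 * X ^ 2 + 8) (v := -X) ?_
    rw [map_ofNat]
    simp [lineTangency]
    ring
  · rw [lineRestriction_map, lineTangency_map, eval_comp_X] at hw
    exact hw.1

lemma holdsGenerically_r₀ :
    HoldsGenerically fun w => IsCoprime (r₀ w) (p₀ w) := by
  have h : r₀ (![0, 1, 1, -8, 0, 0, 0, 1] : Fin 8 → ℂ) = X ^ 2 + 5 := by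
    simp [r₀, base]
    ring
  refine (HoldsGenerically.isCoprime (m := 2) (by norm_num) (r₀ MvPolynomial.X)
    (p₀ MvPolynomial.X) (r₀_natDegree_le _)
    ![0, 1, 1, -8, 0, 0, 0, 1] ?_ ?_).mono fun w hw => ?_
  · rw [r₀_map, eval_comp_X, h]
    compute_degree!
  · rw [r₀_map, p₀_map, eval_comp_X]
    refine isCoprime_of_mul_add_mul_eq_C (c := 6) (by norm_num) (u := 0) (v := 1) ?_
    rw [map_ofNat]
    simp [p₀, slope]
  · rw [r₀_map, p₀_map, eval_comp_X] at hw
    exact hw.1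

lemma holdsGenerically_apply_ne_zero (i : Fin 8) : HoldsGenerically fun w => w i ≠ 0 :=
  (HoldsGenerically.eval_ne_zero (MvPolynomial.X i) 1 (by simp)).mono fun w hw => by simpa using hw

lemma holdsGenerically_isGeneric : HoldsGenerically IsGeneric := by
  have hsing : HoldsGenerically fun w => 3 * w 4 * w 1 - 2 * w 5 * w 0 ≠ 0 :=
    (HoldsGenerically.eval_ne_zero (3 * MvPolynomial.X 4 * MvPolynomial.X 1
      - 2 * MvPolynomial.X 5 * MvPolynomial.X 0) 1 (by norm_num)).mono
      fun w hw => by simpa using hw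
  have horigin : HoldsGenerically fun w =>
      w 5 * (2 * w 0 + 3 * w 1 + 5 * w 2 + w 3) + 3 * w 7 * w 1 ≠ 0 :=
    (HoldsGenerically.eval_ne_zero (MvPolynomial.X 5 * (2 * MvPolynomial.X 0
      + 3 * MvPolynomial.X 1 + 5 * MvPolynomial.X 2 + MvPolynomial.X 3)
      + 3 * MvPolynomial.X 7 * MvPolynomial.X 1) 1 (by norm_num)).mono
      fun w hw => by simpa using hw
  refine (holdsGenerically_elimR.and <| holdsGenerically_elimD.and <|
    holdsGenerically_elimK.and <| holdsGenerically_slope.and <| holdsGenerically_line.and <|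
    holdsGenerically_r₀.and <| (holdsGenerically_apply_ne_zero 1).and <|
    (holdsGenerically_apply_ne_zero 4).and <| (holdsGenerically_apply_ne_zero 5).and <|
    (holdsGenerically_apply_ne_zero 6).and <| (holdsGenerically_apply_ne_zero 7).and <|
    hsing.and horigin).mono ?_
  rintro w ⟨⟨h₁, h₂⟩, h₃, ⟨h₄, h₅⟩, h₆, h₇, h₈, h₉, h₁₀, h₁₁, h₁₂, h₁₃, h₁₄, h₁₅⟩
  exact ⟨h₂, h₁, h₃, h₅, h₄, h₆, h₇, h₈, h₉, h₁₀, h₁₁, h₁₂, h₁₃, h₁₄, h₁₅⟩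

/-- The linear form `ℓ` at the point `(2 + s * t, 3 + s, 5 + t ^ 2)` of the umbrella. -/
def linForm (w : Fin 8 → ℂ) (s t : ℂ) : ℂ :=
  w 0 * (2 + s * t) + w 1 * (3 + s) + w 2 * (5 + t ^ 2) + w 3

/-- The cleared critical equation in the direction `∂/∂s`. -/
def critS (w : Fin 8 → ℂ) (s t : ℂ) : ℂ :=
  w 4 * t * (3 + s) * linForm w s t + w 5 * (2 + s * t) * linForm w s t
    + w 7 * (w 0 * t + w 1) * (2 + s * t) * (3 + s)

/-- The cleared critical equation in the direction `∂/∂t`. -/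
def critT (w : Fin 8 → ℂ) (s t : ℂ) : ℂ :=
  w 4 * s * (5 + t ^ 2) * linForm w s t + 2 * w 6 * t * (2 + s * t) * linForm w s t
    + w 7 * (w 0 * s + 2 * w 2 * t) * (2 + s * t) * (5 + t ^ 2)

variable {w : Fin 8 → ℂ} {s t : ℂ}

lemma critS_eq (w : Fin 8 → ℂ) (s t : ℂ) :
    critS w s t = (p₂ w).eval t * s ^ 2 + (p₁ w).eval t * s + (p₀ w).eval t := by
  simp [critS, linForm, p₀, p₁, p₂, slope, base]
  ring

lemma critT_eq (w : Fin 8 → ℂ) (s t : ℂ) :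
    critT w s t = (q₂ w).eval t * s ^ 2 + (q₁ w).eval t * s + (q₀ w).eval t := by
  simp [critT, linForm, q₀, r₀, q₁, q₂, slope, base]
  ring

lemma linForm_eq (w : Fin 8 → ℂ) (s t : ℂ) :
    linForm w s t = (slope w).eval t * s + (base w).eval t := by
  simp [linForm, slope, base]
  ring

lemma mul_linForm_of_add_mul_eq_zero (h : 2 + s * t = 0) :
    t * linForm w s t = (elimK w).eval t := by
  simp [linForm, elimK]
  linear_combination (w 0 * t + w 1) * h

lemma eval_elimD_mul_add_eval_elimN (hS : critS w s t = 0) (hT : critT w s t = 0) :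
    (elimD w).eval t * s + (elimN w).eval t = 0 := by
  rw [critS_eq] at hS
  rw [critT_eq] at hT
  simp only [elimD, elimN, eval_sub, eval_mul]
  linear_combination (q₂ w).eval t * hS - (p₂ w).eval t * hT

lemma eval_elimR_eq_zero (hS : critS w s t = 0) (hT : critT w s t = 0) :
    (elimR w).eval t = 0 := by
  have hN := eval_elimD_mul_add_eval_elimN hS hT
  have hM : (elimM w).eval t = (elimD w).eval t * s ^ 2 := by
    rw [critS_eq] at hS
    rw [critT_eq] at hT
    simp only [elimD, elimM, eval_sub, eval_mul]
    linear_combination (q₁ w).eval t * hS - (p₁ w).eval t * hT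
  simp only [elimR, eval_sub, eval_mul, eval_pow, hM]
  linear_combination ((elimN w).eval t - (elimD w).eval t * s) * hN

lemma critS_critT_eq_zero (hD : (elimD w).eval t ≠ 0) (hR : (elimR w).eval t = 0)
    (hs : (elimD w).eval t * s + (elimN w).eval t = 0) : critS w s t = 0 ∧ critT w s t = 0 := by
  have key : ∀ x y : ℂ, (elimD w).eval t ^ 2 * x = y * (elimR w).eval t → x = 0 := by
    intro x y h
    rw [hR, mul_zero] at h
    exact (mul_eq_zero.1 h).resolve_left (pow_ne_zero _ hD)
  have hN : (elimN w).eval t = -((elimD w).eval t * s) := by linear_combination hs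
  refine ⟨key _ ((p₂ w).eval t) ?_, key _ ((q₂ w).eval t) ?_⟩
  · rw [critS_eq]
    have h : (p₁ w).eval t * (elimN w).eval t - (p₀ w).eval t * (elimD w).eval t =
        (p₂ w).eval t * (elimM w).eval t := by
      simp only [elimD, elimM, elimN, eval_sub, eval_mul]; ring
    simp only [elimR, eval_sub, eval_mul, eval_pow]
    rw [hN] at h ⊢
    linear_combination (-(elimD w).eval t) * h
  · rw [critT_eq]
    have h : (q₁ w).eval t * (elimN w).eval t - (q₀ w).eval t * (elimD w).eval t =
        (q₂ w).eval t * (elimM w).eval t := by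
      simp only [elimD, elimM, elimN, eval_sub, eval_mul]; ring
    simp only [elimR, eval_sub, eval_mul, eval_pow]
    rw [hN] at h ⊢
    linear_combination (-(elimD w).eval t) * h

lemma eval_ne_zero_of_isCoprime {f g : ℂ[X]} (h : IsCoprime f g) (t : ℂ) (hf : f.eval t = 0) :
    g.eval t ≠ 0 := by
  intro hg
  obtain ⟨a, b, hab⟩ := h
  simpa [hf, hg] using congrArg (eval t) hab

namespace IsGeneric

lemma eval_elimD_ne_zero (h : IsGeneric w) (hR : (elimR w).eval t = 0) :
    (elimD w).eval t ≠ 0 := by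
  intro hD
  refine eval_ne_zero_of_isCoprime h.isCoprime_elimD_elimN t hD ?_
  simpa [elimR, hD] using hR

lemma ne_zero_of_eval_elimK (h : IsGeneric w) (hK : (elimK w).eval t = 0) : t ≠ 0 := by
  rintro rfl
  exact h.w1_ne (by simpa [elimK] using hK)

/-- Roots of `elimK` are the common zeros of the cleared equations on `2 + s * t = 0`. -/
lemma crit_of_eval_elimK (h : IsGeneric w) (hK : (elimK w).eval t = 0) :
    critS w (-2 / t) t = 0 ∧ critT w (-2 / t) t = 0 := by
  have ht := h.ne_zero_of_eval_elimK hK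
  have hst : 2 + -2 / t * t = 0 := by field_simp; ring
  have hL : linForm w (-2 / t) t = 0 := by
    have := mul_linForm_of_add_mul_eq_zero (w := w) hst
    rw [hK] at this
    exact (mul_eq_zero.1 this).resolve_left ht
  simp only [critS, critT, hL, hst]
  constructor <;> ring

lemma eval_elimR_of_eval_elimK (h : IsGeneric w) (hK : (elimK w).eval t = 0) :
    (elimR w).eval t = 0 :=
  eval_elimR_eq_zero (h.crit_of_eval_elimK hK).1 (h.crit_of_eval_elimK hK).2

lemma eval_elimK_ne_zero (h : IsGeneric w) (hS : critS w s t = 0) (hT : critT w s t = 0)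
    (hst : 2 + s * t ≠ 0) : (elimK w).eval t ≠ 0 := by
  intro hK
  obtain ⟨hS', hT'⟩ := h.crit_of_eval_elimK hK
  have h₁ := eval_elimD_mul_add_eval_elimN hS hT
  have h₂ := eval_elimD_mul_add_eval_elimN hS' hT'
  have hs : s = -2 / t :=
    mul_left_cancel₀ (h.eval_elimD_ne_zero (eval_elimR_eq_zero hS hT))
      (by linear_combination h₁ - h₂)
  have ht := h.ne_zero_of_eval_elimK hK
  exact hst (by rw [hs]; field_simp; ring)

lemma two_add_ne_zero (h : IsGeneric w) (hS : critS w s t = 0) (hT : critT w s t = 0)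
    (hK : (elimK w).eval t ≠ 0) : 2 + s * t ≠ 0 := by
  intro hst
  have hL := mul_linForm_of_add_mul_eq_zero (w := w) hst
  rw [← hL] at hK
  have ht := left_ne_zero_of_mul hK
  have hl := right_ne_zero_of_mul hK
  have hs : s ≠ 0 := by
    rintro rfl
    norm_num at hst
  have h₁ : 3 + s = 0 := by simpa [critS, hst, h.w4_ne, ht, hl] using hS
  have h₂ : 5 + t ^ 2 = 0 := by simpa [critT, hst, h.w4_ne, hs, hl] using hT
  have : (49 : ℂ) = 0 := by
    linear_combination 9 * h₂ + (3 * t + 2) * hst - (3 * t + 2) * t * h₁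
  norm_num at this

lemma linForm_ne_zero (h : IsGeneric w) (hS : critS w s t = 0) (hT : critT w s t = 0)
    (hst : 2 + s * t ≠ 0) : linForm w s t ≠ 0 := by
  intro hL
  have hS' : w 0 * t + w 1 = 0 ∨ 3 + s = 0 := by simpa [critS, hL, h.w7_ne, hst] using hS
  have hT' : w 0 * s + 2 * w 2 * t = 0 ∨ 5 + t ^ 2 = 0 := by
    simpa [critT, hL, h.w7_ne, hst] using hT
  rw [linForm_eq] at hL
  rcases hS' with hA | hs
  · have hA' : (slope w).eval t = 0 := by simpa [slope] using hA
    exact eval_ne_zero_of_isCoprime h.isCoprime_slope_base t hA' (by simpa [hA'] using hL)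
  · obtain rfl : s = -3 := by linear_combination hs
    refine eval_ne_zero_of_isCoprime h.isCoprime_line t ?_ ?_
    · simp only [lineRestriction, eval_sub, eval_mul, eval_ofNat]
      linear_combination hL
    · simp only [lineTangency, eval_sub, eval_mul, eval_ofNat, eval_C, eval_X, eval_add, eval_pow]
      rcases hT' with h' | h'
      · linear_combination (5 + t ^ 2) * h'
      · linear_combination (2 * w 2 * t - 3 * w 0) * h'

lemma three_add_ne_zero (h : IsGeneric w) (hS : critS w s t = 0)
    (hst : 2 + s * t ≠ 0) (hL : linForm w s t ≠ 0) : 3 + s ≠ 0 := by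
  intro hs
  simp [critS, hs, h.w5_ne, hst, hL] at hS

lemma five_add_ne_zero (h : IsGeneric w) (hT : critT w s t = 0)
    (hst : 2 + s * t ≠ 0) (hL : linForm w s t ≠ 0) : 5 + t ^ 2 ≠ 0 := by
  intro ht
  have h0 : t = 0 := by simpa [critT, ht, h.w6_ne, hst, hL] using hT
  simp [h0] at ht

lemma ne_zero (h : IsGeneric w) (hS : critS w s t = 0) (hT : critT w s t = 0) : s ≠ 0 := by
  rintro rfl
  have hp : (p₀ w).eval t = 0 := by simpa [critS_eq] using hS
  have hq : t = 0 ∨ (r₀ w).eval t = 0 := by simpa [critT_eq, q₀] using hT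
  rcases hq with rfl | hq
  · refine h.origin_ne ?_
    simp [p₀, base, slope] at hp
    linear_combination hp / 2
  · exact eval_ne_zero_of_isCoprime h.isCoprime_r₀_p₀ t hq hp

end IsGeneric

lemma eval_umbrella (z : Fin 3 → ℂ) :
    MvPolynomial.eval z umbrella = (z 0 - 2) ^ 2 - (z 1 - 3) ^ 2 * (z 2 - 5) := by
  simp [umbrella]

lemma umbrella_eq : umbrella = (MvPolynomial.X 0 - MvPolynomial.C 2) ^ 2
    - (MvPolynomial.X 1 - MvPolynomial.C 3) ^ 2 * (MvPolynomial.X 2 - MvPolynomial.C 5) := by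
  simp only [umbrella, map_ofNat]

lemma eval_pderiv_zero_umbrella (z : Fin 3 → ℂ) :
    MvPolynomial.eval z (MvPolynomial.pderiv 0 umbrella) = 2 * (z 0 - 2) := by
  simp [umbrella_eq, MvPolynomial.pderiv_X, Derivation.leibniz_pow]

lemma eval_pderiv_one_umbrella (z : Fin 3 → ℂ) :
    MvPolynomial.eval z (MvPolynomial.pderiv 1 umbrella) = -2 * (z 1 - 3) * (z 2 - 5) := by
  simp [umbrella_eq, MvPolynomial.pderiv_X, Derivation.leibniz_pow]
  ring

lemma eval_pderiv_two_umbrella (z : Fin 3 → ℂ) :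
    MvPolynomial.eval z (MvPolynomial.pderiv 2 umbrella) = -(z 1 - 3) ^ 2 := by
  simp [umbrella_eq, MvPolynomial.pderiv_X, Derivation.leibniz_pow]

/-- The set of ML-critical points of the umbrella with the hyperplane `ℓ` removed. -/
def critSet (w : Fin 8 → ℂ) : Set (Fin 3 → ℂ) :=
  {z : Fin 3 → ℂ | (∀ i, z i ≠ 0) ∧ MvPolynomial.eval z umbrella = 0 ∧
    w 0 * z 0 + w 1 * z 1 + w 2 * z 2 + w 3 ≠ 0 ∧
    ∃ lam : ℂ,
      w 4 / z 0 + w 7 * w 0 / (w 0 * z 0 + w 1 * z 1 + w 2 * z 2 + w 3)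
        = lam * MvPolynomial.eval z (MvPolynomial.pderiv 0 umbrella) ∧
      w 5 / z 1 + w 7 * w 1 / (w 0 * z 0 + w 1 * z 1 + w 2 * z 2 + w 3)
        = lam * MvPolynomial.eval z (MvPolynomial.pderiv 1 umbrella) ∧
      w 6 / z 2 + w 7 * w 2 / (w 0 * z 0 + w 1 * z 1 + w 2 * z 2 + w 3)
        = lam * MvPolynomial.eval z (MvPolynomial.pderiv 2 umbrella)}

/-- The parametrization of the umbrella off its singular line. -/
def point (s t : ℂ) : Fin 3 → ℂ := ![2 + s * t, 3 + s, 5 + t ^ 2]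

lemma point_mem_critSet_iff (hs : s ≠ 0) :
    point s t ∈ critSet w ↔ 2 + s * t ≠ 0 ∧ 3 + s ≠ 0 ∧ 5 + t ^ 2 ≠ 0 ∧ linForm w s t ≠ 0 ∧
      critS w s t = 0 ∧ critT w s t = 0 := by
  have hf : MvPolynomial.eval ![2 + s * t, 3 + s, 5 + t ^ 2] umbrella = 0 := by
    rw [eval_umbrella]
    simp
    ring
  have hl : w 0 * (2 + s * t) + w 1 * (3 + s) + w 2 * (5 + t ^ 2) + w 3 = linForm w s t := rfl
  simp only [critSet, Set.mem_ofPred_eq, hf, eval_pderiv_zero_umbrella, eval_pderiv_one_umbrella,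
    eval_pderiv_two_umbrella, Fin.forall_fin_succ, point, Fin.isValue, Matrix.cons_val_zero,
    Matrix.cons_val_one, Matrix.cons_val, hl, true_and, Fin.succ_zero_eq_one, Fin.succ_one_eq_two,
    IsEmpty.forall_iff, and_true]
  constructor
  · rintro ⟨⟨h₁, h₂, h₃⟩, hL, lam, e₁, e₂, e₃⟩
    have h₁' : 2 + t * s ≠ 0 := by rwa [mul_comm t s]
    refine ⟨h₁, h₂, h₃, hL, ?_, ?_⟩
    · have : t * (w 4 / (2 + s * t) + w 7 * w 0 / linForm w s t)
          + (w 5 / (3 + s) + w 7 * w 1 / linForm w s t) = 0 := by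
        rw [e₁, e₂]; ring
      field_simp at this
      rw [critS]
      linear_combination this
    · have : s * (w 4 / (2 + s * t) + w 7 * w 0 / linForm w s t)
          + 2 * t * (w 6 / (5 + t ^ 2) + w 7 * w 2 / linForm w s t) = 0 := by
        rw [e₁, e₃]; ring
      field_simp at this
      rw [critT]
      linear_combination this
  · rintro ⟨h₁, h₂, h₃, hL, hS, hT⟩
    have h₁' : 2 + t * s ≠ 0 := by rwa [mul_comm t s]
    refine ⟨⟨h₁, h₂, h₃⟩, hL, -(w 6 / (5 + t ^ 2) + w 7 * w 2 / linForm w s t) / s ^ 2, ?_⟩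
    have e₁ : t * (w 4 / (2 + s * t) + w 7 * w 0 / linForm w s t)
        + (w 5 / (3 + s) + w 7 * w 1 / linForm w s t) = 0 := by
      field_simp
      rw [critS] at hS
      linear_combination hS
    have e₂ : s * (w 4 / (2 + s * t) + w 7 * w 0 / linForm w s t)
        + 2 * t * (w 6 / (5 + t ^ 2) + w 7 * w 2 / linForm w s t) = 0 := by
      field_simp
      rw [critT] at hT
      linear_combination hT
    generalize w 4 / (2 + s * t) + w 7 * w 0 / linForm w s t = x at *
    generalize w 5 / (3 + s) + w 7 * w 1 / linForm w s t = y at *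
    generalize w 6 / (5 + t ^ 2) + w 7 * w 2 / linForm w s t = r at *
    refine ⟨?_, ?_, ?_⟩
    · field_simp
      linear_combination s * e₂
    · field_simp
      linear_combination s * (s * e₁ - t * e₂)
    · field_simp
      ring

lemma exists_eq_point (h : IsGeneric w) {z : Fin 3 → ℂ} (hz : z ∈ critSet w) :
    ∃ s t, s ≠ 0 ∧ z = point s t := by
  obtain ⟨hz0, hf, hL, lam, e₁, e₂, -⟩ := hz
  rw [eval_umbrella] at hf
  rw [eval_pderiv_zero_umbrella] at e₁
  rw [eval_pderiv_one_umbrella] at e₂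
  have hs : z 1 - 3 ≠ 0 := by
    intro h1
    have h0 : z 0 - 2 = 0 := by simpa [h1] using hf
    rw [h0] at e₁
    rw [h1] at e₂
    have h0' : z 0 = 2 := by linear_combination h0
    have h1' : z 1 = 3 := by linear_combination h1
    rw [h0', h1'] at e₁ e₂
    exact h.sing_ne (by linear_combination 6 * w 1 * e₁ - 6 * w 0 * e₂)
  refine ⟨z 1 - 3, (z 0 - 2) / (z 1 - 3), hs, ?_⟩
  have h2 : z 2 = 5 + ((z 0 - 2) / (z 1 - 3)) ^ 2 := by
    field_simp
    linear_combination -hf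
  ext i
  fin_cases i
  · simp [point]
    field_simp
    ring
  · simp [point]
  · simpa [point] using h2

lemma critSet_eq_image (h : IsGeneric w) :
    critSet w = (fun t => point (-(elimN w).eval t / (elimD w).eval t) t) ''
      {t | (elimR w).eval t = 0 ∧ (elimK w).eval t ≠ 0} := by
  ext z
  constructor
  · intro hz
    obtain ⟨s, t, hs, rfl⟩ := exists_eq_point h hz
    obtain ⟨h₁, -, -, -, hS, hT⟩ := (point_mem_critSet_iff hs).1 hz
    have hR := eval_elimR_eq_zero hS hT
    have hD := h.eval_elimD_ne_zero hR
    refine ⟨t, ⟨hR, h.eval_elimK_ne_zero hS hT h₁⟩, ?_⟩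
    have : -(elimN w).eval t / (elimD w).eval t = s := by
      rw [div_eq_iff hD]
      linear_combination -eval_elimD_mul_add_eval_elimN hS hT
    simp only [this]
  · rintro ⟨t, ⟨hR, hK⟩, rfl⟩
    have hD := h.eval_elimD_ne_zero hR
    obtain ⟨hS, hT⟩ := critS_critT_eq_zero (s := -(elimN w).eval t / (elimD w).eval t) hD hR
      (by field_simp; ring)
    have h₁ := h.two_add_ne_zero hS hT hK
    have hL := h.linForm_ne_zero hS hT h₁
    exact (point_mem_critSet_iff (h.ne_zero hS hT)).2
      ⟨h₁, h.three_add_ne_zero hS h₁ hL, h.five_add_ne_zero hT h₁ hL, hL, hS, hT⟩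

lemma injOn_point (h : IsGeneric w) :
    Set.InjOn (fun t => point (-(elimN w).eval t / (elimD w).eval t) t)
      {t | (elimR w).eval t = 0 ∧ (elimK w).eval t ≠ 0} := by
  rintro t ⟨hR, -⟩ t' - heq
  have hD := h.eval_elimD_ne_zero hR
  obtain ⟨hS, hT⟩ := critS_critT_eq_zero (s := -(elimN w).eval t / (elimD w).eval t) hD hR
    (by field_simp; ring)
  have hs := h.ne_zero hS hT
  have h0 := congrFun heq 0
  have h1 := congrFun heq 1
  simp only [point, Matrix.cons_val_zero, Matrix.cons_val_one, add_right_inj] at h0 h1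
  rw [← h1] at h0
  exact mul_left_cancel₀ hs h0

lemma card_roots_toFinset {f : ℂ[X]} (hf : f.Separable) : f.roots.toFinset.card = f.natDegree := by
  rw [Multiset.toFinset_card_of_nodup (nodup_roots hf)]
  exact (IsAlgClosed.splits f).natDegree_eq_card_roots.symm

lemma ncard_critSet (h : IsGeneric w) : (critSet w).ncard = 10 := by
  rw [critSet_eq_image h, (injOn_point h).ncard_image]
  have hR := h.separable_elimR.ne_zero
  have hK := h.separable_elimK.ne_zero
  have hset : {t | (elimR w).eval t = 0 ∧ (elimK w).eval t ≠ 0} =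
      ((elimR w).roots.toFinset \ (elimK w).roots.toFinset : Finset ℂ) := by
    ext t
    simp [hR, hK, IsRoot]
  have hsub : (elimK w).roots.toFinset ⊆ (elimR w).roots.toFinset := by
    intro t ht
    simp only [Multiset.mem_toFinset, mem_roots hK, mem_roots hR, IsRoot] at ht ⊢
    exact h.eval_elimR_of_eval_elimK ht
  rw [hset, Set.ncard_coe_finset, Finset.card_sdiff_of_subset hsub,
    card_roots_toFinset h.separable_elimR, card_roots_toFinset h.separable_elimK,
    h.natDegree_elimR, h.natDegree_elimK]

end Polynomial.Umbrella

/-- **The first removal ML degree of the shifted Whitney umbrella is `r₁ = 10`.**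
For generic `(a₁, a₂, a₃, b, u₁, u₂, u₃, u₄) ∈ ℂ⁸` (encoded as `w 0, …, w 7`),
writing `ℓ(z) = a₁z₁ + a₂z₂ + a₃z₃ + b`, there are exactly `10` ML-critical
points of the umbrella with the hyperplane `ℓ` removed. -/
theorem umbrella_removal_ml_degree_one :
    ∃ g : MvPolynomial (Fin 8) ℂ, g ≠ 0 ∧
      ∀ w : Fin 8 → ℂ, eval w g ≠ 0 →
        {z : Fin 3 → ℂ | (∀ i, z i ≠ 0) ∧ eval z umbrella = 0 ∧
            w 0 * z 0 + w 1 * z 1 + w 2 * z 2 + w 3 ≠ 0 ∧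
            ∃ lam : ℂ,
              w 4 / z 0 + w 7 * w 0 / (w 0 * z 0 + w 1 * z 1 + w 2 * z 2 + w 3)
                = lam * eval z (pderiv 0 umbrella) ∧
              w 5 / z 1 + w 7 * w 1 / (w 0 * z 0 + w 1 * z 1 + w 2 * z 2 + w 3)
                = lam * eval z (pderiv 1 umbrella) ∧
              w 6 / z 2 + w 7 * w 2 / (w 0 * z 0 + w 1 * z 1 + w 2 * z 2 + w 3)
                = lam * eval z (pderiv 2 umbrella)}.ncard = 10 := by
  obtain ⟨g, hg, h⟩ := Polynomial.Umbrella.holdsGenerically_isGeneric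
  exact ⟨g, hg, fun w hw => Polynomial.Umbrella.ncard_critSet (h w hw)⟩
end

section
/- Let f := (z₁ − 2)² − (z₂ − 3)²(z₃ − 5) ∈ ℂ[z₁,z₂,z₃] and let P := (2, 3, 5). For generic (a, a', u) ∈ ℂ³ × ℂ³ × ℂ⁴, writing ℓ₁(z) := Σ_i a_i(z_i − P_i) and ℓ₂(z) := Σ_i a'_i(z_i − P_i), the set {z ∈ (ℂ*)³ : f(z) = 0, ℓ₁(z) = 0, ℓ₂(z) ≠ 0, and there exist λ, μ ∈ ℂ with u_i/z_i + u₄·a'_i/ℓ₂(z) = λ·(∂f/∂z_i)(z) + μ·a_i for i = 1,2,3} has exactly 9 elements. (The second removal ML degree of the shifted Whitney umbrella with respect to the point P = (2,3,5) of its singular line is r₂(P,X) = 9.) -/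
open MvPolynomial

/-- The pinch point `P = (2, 3, 5)` of the shifted Whitney umbrella. -/
noncomputable def pinchPt : Fin 3 → ℂ := ![2, 3, 5]

namespace UmbrellaSection

/-! ### Generic separability -/

/-- If one specialization of a polynomial with polynomial coefficients is separable of the maximal
possible degree, then so is the generic specialization. -/
theorem exists_generic_separable {σ K : Type*} [Field K]
    (F : Polynomial (MvPolynomial σ K)) (n : ℕ) (hF : F.natDegree ≤ n) (hn : n ≠ 0)
    (p₀ : σ → K) (hdeg : (F.map (eval p₀)).natDegree = n)
    (hsep : (F.map (eval p₀)).Separable) :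
    ∃ G : MvPolynomial σ K, G ≠ 0 ∧ ∀ p : σ → K, eval p G ≠ 0 →
      (F.map (eval p)).natDegree = n ∧ (F.map (eval p)).Separable := by
  have hF' : (Polynomial.derivative F).natDegree ≤ n :=
    (Polynomial.natDegree_derivative_le F).trans ((Nat.sub_le _ _).trans hF)
  have hlead : (F.map (eval p₀)).coeff n ≠ 0 := by
    intro h
    rw [← hdeg, Polynomial.coeff_natDegree, Polynomial.leadingCoeff_eq_zero] at h
    exact hn (by rw [← hdeg, h, Polynomial.natDegree_zero])
  refine ⟨F.coeff n * F.resultant (Polynomial.derivative F) n n, ?_, fun p hp => ?_⟩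
  · intro h
    have h' := congrArg (eval p₀) h
    rw [map_mul, map_zero, ← Polynomial.resultant_map_map, ← Polynomial.coeff_map,
      mul_eq_zero, or_iff_right hlead, ← Polynomial.derivative_map] at h'
    have hle : (Polynomial.derivative (F.map (eval p₀))).natDegree ≤ n := by
      rw [Polynomial.derivative_map]
      exact Polynomial.natDegree_map_le.trans hF'
    obtain ⟨k, hk⟩ := Nat.exists_eq_add_of_le hle
    have hres := Polynomial.resultant_add_right_deg (F.map (eval p₀))
      (Polynomial.derivative (F.map (eval p₀))) n
      (Polynomial.derivative (F.map (eval p₀))).natDegree k le_rfl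
    rw [← hk, h', eq_comm, mul_eq_zero, or_iff_right (pow_ne_zero _ hlead)] at hres
    exact Polynomial.resultant_ne_zero _ _ hsep (by rw [hdeg]; exact hres)
  · rw [map_mul] at hp
    obtain ⟨hc, hr⟩ := mul_ne_zero_iff.mp hp
    refine ⟨le_antisymm (Polynomial.natDegree_map_le.trans hF)
      (Polynomial.le_natDegree_of_ne_zero (by rwa [Polynomial.coeff_map])), ?_⟩
    obtain ⟨A, B, -, -, hAB⟩ := Polynomial.exists_mul_add_mul_eq_C_resultant F
      (Polynomial.derivative F) hF hF' (Or.inl hn)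
    have h := congrArg (Polynomial.map (eval p)) hAB
    rw [Polynomial.map_add, Polynomial.map_mul, Polynomial.map_mul, Polynomial.map_C] at h
    set r := eval p (F.resultant (Polynomial.derivative F) n n)
    refine ⟨Polynomial.C r⁻¹ * A.map (eval p), Polynomial.C r⁻¹ * B.map (eval p), ?_⟩
    rw [Polynomial.derivative_map]
    calc _ = Polynomial.C r⁻¹ * (F.map (eval p) * A.map (eval p)
          + (Polynomial.derivative F).map (eval p) * B.map (eval p)) := by ring
      _ = 1 := by rw [h, ← Polynomial.C_mul, inv_mul_cancel₀ hr, Polynomial.C_1]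

theorem isCoprime_of_no_common_root {f g : Polynomial ℂ}
    (h : ∀ x : ℂ, f.eval x = 0 → g.eval x = 0 → False) : IsCoprime f g := by
  rw [Polynomial.isCoprime_iff_aeval_ne_zero_of_isAlgClosed ℂ ℂ]
  intro x
  by_contra! hx
  exact h x (by simpa using hx.1) (by simpa using hx.2)

/-! ### The rational parametrization of the section -/

section Polynomials

variable {A B : Type*} [CommRing A] [CommRing B]

/-- Common denominator `D` of the parametrization `t ↦ (2 - a₃t³/D, 3 - a₃t²/D, 5 + t²)` of the
section of the umbrella by `ℓ₁ = 0`. -/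
noncomputable def den (a : Fin 3 → A) : Polynomial A := .C (a 0) * .X + .C (a 1)

/-- Numerator of the first coordinate of the parametrization. -/
noncomputable def num₀ (a : Fin 3 → A) : Polynomial A := 2 * den a - .C (a 2) * .X ^ 3

/-- Numerator of the second coordinate of the parametrization. -/
noncomputable def num₁ (a : Fin 3 → A) : Polynomial A := 3 * den a - .C (a 2) * .X ^ 2

/-- The third coordinate of the parametrization. -/
noncomputable def num₂ : Polynomial A := .X ^ 2 + 5

/-- The factor `L` in `ℓ₂ = t² L / D`. -/
noncomputable def lin (a a' : Fin 3 → A) : Polynomial A :=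
  .C (a' 2 * a 0 - a' 0 * a 2) * .X + .C (a' 2 * a 1 - a' 1 * a 2)

/-- The numerator of the logarithmic derivative of `t² L / D`. -/
noncomputable def linCrit (a a' : Fin 3 → A) : Polynomial A :=
  .C (2 * a 0 * (a' 2 * a 0 - a' 0 * a 2)) * .X ^ 2
  + .C (3 * a 1 * (a' 2 * a 0 - a' 0 * a 2) + a 0 * (a' 2 * a 1 - a' 1 * a 2)) * .X
  + .C (2 * a 1 * (a' 2 * a 1 - a' 1 * a 2))

/-- The product of all finite poles of the logarithmic derivative. -/
noncomputable def polePoly (a a' : Fin 3 → A) : Polynomial A :=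
  num₀ a * num₁ a * num₂ * .X * lin a a' * den a

/-- The numerator of the logarithmic derivative of `z₁^u₁ z₂^u₂ z₃^u₃ ℓ₂^u₄` along the
parametrization. -/
noncomputable def critPoly (a a' : Fin 3 → A) (u : Fin 4 → A) : Polynomial A :=
  num₀ a * num₁ a * num₂ * linCrit a a' * .C (u 3)
  + 2 * .C (u 2) * .X ^ 2 * (num₀ a * num₁ a * lin a a' * den a)
  - .C (u 1 * a 2) * .X ^ 2 * (.C (a 0) * .X + .C (2 * a 1)) * (num₀ a * num₂ * lin a a')
  - .C (u 0 * a 2) * .X ^ 3 * (.C (2 * a 0) * .X + .C (3 * a 1)) * (num₁ a * num₂ * lin a a')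

theorem map_polePoly (φ : A →+* B) (a a' : Fin 3 → A) :
    (polePoly a a').map φ = polePoly (φ ∘ a) (φ ∘ a') := by
  simp [polePoly, num₀, num₁, num₂, lin, den]

theorem map_critPoly (φ : A →+* B) (a a' : Fin 3 → A) (u : Fin 4 → A) :
    (critPoly a a' u).map φ = critPoly (φ ∘ a) (φ ∘ a') (φ ∘ u) := by
  simp [critPoly, num₀, num₁, num₂, lin, linCrit, den, map_ofNat φ]

theorem natDegree_polePoly_le (a a' : Fin 3 → A) : (polePoly a a').natDegree ≤ 10 := by
  unfold polePoly num₀ num₁ num₂ lin den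
  compute_degree

theorem natDegree_critPoly_le (a a' : Fin 3 → A) (u : Fin 4 → A) :
    (critPoly a a' u).natDegree ≤ 9 := by
  unfold critPoly num₀ num₁ num₂ lin linCrit den
  compute_degree

end Polynomials

/-! ### A specialization with separable pole and critical polynomials -/

/-- Coefficients of `ℓ₁` at the test point. -/
def testA : Fin 3 → ℂ := ![1, 1, 1]

/-- Coefficients of `ℓ₂` at the test point. -/
def testA' : Fin 3 → ℂ := ![-1, 1, 0]

/-- Exponents at the test point. -/
def testU : Fin 4 → ℂ := ![0, 0, 0, 1]

theorem separable_num_mul :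
    (num₀ testA * num₁ testA * num₂).Separable := by
  refine .mul (.mul ?_ ?_ ?_) ?_ (.mul_left ?_ ?_)
  all_goals
    refine isCoprime_of_no_common_root fun x h h' => ?_
    simp [num₀, num₁, num₂, den, testA] at h h'
    grind

theorem separable_polePoly_test : (polePoly testA testA').Separable := by
  refine .mul (.mul (.mul separable_num_mul Polynomial.separable_X ?_) ?_ ?_) ?_ ?_
  all_goals
    refine isCoprime_of_no_common_root fun x h h' => ?_
    simp [num₀, num₁, num₂, den, lin, testA, testA'] at h h' <;> grind

theorem separable_critPoly_test : (critPoly testA testA' testU).Separable := by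
  have h : critPoly testA testA' testU =
      num₀ testA * num₁ testA * num₂ * linCrit testA testA' := by
    simp [critPoly, testU]
  rw [h]
  refine .mul separable_num_mul ?_ ?_
  all_goals
    refine isCoprime_of_no_common_root fun x h h' => ?_
    simp [num₀, num₁, num₂, den, linCrit, testA, testA'] at h h'
    grind

theorem natDegree_polePoly_test : (polePoly testA testA').natDegree = 10 := by
  unfold polePoly num₀ num₁ num₂ lin den testA testA'
  compute_degree
  all_goals simp

theorem natDegree_critPoly_test : (critPoly testA testA' testU).natDegree = 9 := by
  unfold critPoly num₀ num₁ num₂ lin linCrit den testA testA' testU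
  compute_degree
  all_goals simp

/-! ### Critical points on the parametrized section -/

variable {a a' : Fin 3 → ℂ} {u : Fin 4 → ℂ}

theorem eval_critPoly (a a' : Fin 3 → ℂ) (u : Fin 4 → ℂ) (t : ℂ) :
    (critPoly a a' u).eval t =
      u 0 * ((2 * a 0 - 3 * a 2 * t ^ 2) * ((num₁ a).eval t * num₂.eval t * t *
        (lin a a').eval t * (den a).eval t))
      + u 1 * ((3 * a 0 - 2 * a 2 * t) * ((num₀ a).eval t * num₂.eval t * t *
        (lin a a').eval t * (den a).eval t))
      + u 2 * (2 * t * ((num₀ a).eval t * (num₁ a).eval t * t *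
        (lin a a').eval t * (den a).eval t))
      + u 3 * ((2 * (lin a a').eval t + (a' 2 * a 0 - a' 0 * a 2) * t) *
        ((num₀ a).eval t * (num₁ a).eval t * num₂.eval t * (den a).eval t))
      - (u 0 + u 1 + u 3) * (a 0 * ((num₀ a).eval t * (num₁ a).eval t * num₂.eval t * t *
        (lin a a').eval t)) := by
  simp [critPoly, num₀, num₁, num₂, lin, linCrit, den]
  ring

theorem eval_derivative_polePoly (a a' : Fin 3 → ℂ) (t : ℂ) :
    (Polynomial.derivative (polePoly a a')).eval t =
      (2 * a 0 - 3 * a 2 * t ^ 2) * ((num₁ a).eval t * num₂.eval t * t *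
        (lin a a').eval t * (den a).eval t)
      + (3 * a 0 - 2 * a 2 * t) * ((num₀ a).eval t * num₂.eval t * t *
        (lin a a').eval t * (den a).eval t)
      + 2 * t * ((num₀ a).eval t * (num₁ a).eval t * t *
        (lin a a').eval t * (den a).eval t)
      + ((lin a a').eval t + (a' 2 * a 0 - a' 0 * a 2) * t) *
        ((num₀ a).eval t * (num₁ a).eval t * num₂.eval t * (den a).eval t)
      + a 0 * ((num₀ a).eval t * (num₁ a).eval t * num₂.eval t * t *
        (lin a a').eval t) := by
  simp [polePoly, num₀, num₁, num₂, lin, den]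
  ring

/-- If the poles are simple with nonzero residues, no root of the critical polynomial is a pole. -/
theorem eval_polePoly_ne_zero (hsep : (polePoly a a').Separable) (hu₀ : u 0 ≠ 0) (hu₁ : u 1 ≠ 0)
    (hu₂ : u 2 ≠ 0) (hu₃ : u 3 ≠ 0) (hu : u 0 + u 1 + u 3 ≠ 0) {t : ℂ}
    (ht : (critPoly a a' u).eval t = 0) : (polePoly a a').eval t ≠ 0 := by
  intro hP
  have hd : (Polynomial.derivative (polePoly a a')).eval t ≠ 0 :=
    hsep.eval₂_derivative_ne_zero (RingHom.id ℂ) hP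
  rw [eval_derivative_polePoly] at hd
  rw [eval_critPoly] at ht
  simp only [polePoly, Polynomial.eval_mul, Polynomial.eval_X, mul_eq_zero] at hP
  generalize (num₀ a).eval t = n₀ at *
  generalize (num₁ a).eval t = n₁ at *
  generalize Polynomial.eval t num₂ = n₂ at *
  generalize (lin a a').eval t = l at *
  generalize (den a).eval t = d at *
  rcases hP with ((((h | h) | h) | h) | h) | h <;> subst h <;> simp_all

/-- The point of the section with parameter `t`. -/
noncomputable def curvePt (a : Fin 3 → ℂ) (t : ℂ) : Fin 3 → ℂ :=
  ![2 - a 2 * t ^ 3 / (a 0 * t + a 1), 3 - a 2 * t ^ 2 / (a 0 * t + a 1), 5 + t ^ 2]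

theorem eval_umbrella (z : Fin 3 → ℂ) :
    eval z umbrella = (z 0 - 2) ^ 2 - (z 1 - 3) ^ 2 * (z 2 - 5) := by
  simp [umbrella]

theorem eval_pderiv_umbrella (z : Fin 3 → ℂ) :
    (fun i => eval z (pderiv i umbrella)) =
      ![2 * (z 0 - 2), -2 * (z 1 - 3) * (z 2 - 5), -(z 1 - 3) ^ 2] := by
  have h2 : (2 : MvPolynomial (Fin 3) ℂ) = C 2 := rfl
  have h3 : (3 : MvPolynomial (Fin 3) ℂ) = C 3 := rfl
  have h5 : (5 : MvPolynomial (Fin 3) ℂ) = C 5 := rfl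
  ext i
  fin_cases i <;> simp [umbrella, h2, h3, h5, pderiv_X]; ring

/-- The point `z` satisfies all conditions for an ML-critical point. -/
def IsCrit (a a' : Fin 3 → ℂ) (u : Fin 4 → ℂ) (z : Fin 3 → ℂ) : Prop :=
  (∀ i, z i ≠ 0) ∧ eval z umbrella = 0 ∧
    (∑ i, a i * (z i - pinchPt i)) = 0 ∧
    (∑ i, a' i * (z i - pinchPt i)) ≠ 0 ∧
    ∃ lam mu : ℂ, ∀ i : Fin 3,
      u i.castSucc / z i + u 3 * a' i / (∑ j, a' j * (z j - pinchPt j))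
        = lam * eval z (pderiv i umbrella) + mu * a i

theorem isCrit_iff (z : Fin 3 → ℂ) : IsCrit a a' u z ↔
    (z 0 ≠ 0 ∧ z 1 ≠ 0 ∧ z 2 ≠ 0) ∧ (z 0 - 2) ^ 2 - (z 1 - 3) ^ 2 * (z 2 - 5) = 0 ∧
    a 0 * (z 0 - 2) + a 1 * (z 1 - 3) + a 2 * (z 2 - 5) = 0 ∧
    ∃ s, s = a' 0 * (z 0 - 2) + a' 1 * (z 1 - 3) + a' 2 * (z 2 - 5) ∧ s ≠ 0 ∧
    ∃ lam mu : ℂ,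
      u 0 / z 0 + u 3 * a' 0 / s = lam * (2 * (z 0 - 2)) + mu * a 0 ∧
      u 1 / z 1 + u 3 * a' 1 / s = lam * (-2 * (z 1 - 3) * (z 2 - 5)) + mu * a 1 ∧
      u 2 / z 2 + u 3 * a' 2 / s = lam * (-(z 1 - 3) ^ 2) + mu * a 2 := by
  have h (i : Fin 3) : eval z (pderiv i umbrella) = _ := congrFun (eval_pderiv_umbrella z) i
  simp only [IsCrit, eval_umbrella, h, Fin.sum_univ_three, Fin.forall_fin_succ, pinchPt]
  simp

theorem isCrit_curvePt_iff (ha : a 2 ≠ 0) {t : ℂ} (ht : (polePoly a a').eval t ≠ 0) :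
    IsCrit a a' u (curvePt a t) ↔ (critPoly a a' u).eval t = 0 := by
  simp only [polePoly, Polynomial.eval_mul, Polynomial.eval_X, mul_ne_zero_iff] at ht
  obtain ⟨⟨⟨⟨⟨hn₀, hn₁⟩, hn₂⟩, ht0⟩, hl⟩, hd⟩ := ht
  rw [eval_critPoly]
  obtain ⟨d, hdd⟩ : ∃ d, d = a 0 * t + a 1 := ⟨_, rfl⟩
  obtain ⟨n₀, hnn₀⟩ : ∃ n₀, n₀ = 2 * d - a 2 * t ^ 3 := ⟨_, rfl⟩
  obtain ⟨n₁, hnn₁⟩ : ∃ n₁, n₁ = 3 * d - a 2 * t ^ 2 := ⟨_, rfl⟩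
  obtain ⟨n₂, hnn₂⟩ : ∃ n₂, n₂ = t ^ 2 + 5 := ⟨_, rfl⟩
  obtain ⟨l, hll⟩ : ∃ l, l = (a' 2 * a 0 - a' 0 * a 2) * t + (a' 2 * a 1 - a' 1 * a 2) :=
    ⟨_, rfl⟩
  have ed : (den a).eval t = d := by simp [den, hdd]
  have e₀ : (num₀ a).eval t = n₀ := by simp [num₀, ed, hnn₀]
  have e₁ : (num₁ a).eval t = n₁ := by simp [num₁, ed, hnn₁]
  have e₂ : Polynomial.eval t num₂ = n₂ := by simp [num₂, hnn₂]
  have el : (lin a a').eval t = l := by simp [lin, hll]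
  rw [ed, e₀, e₁, e₂, el]
  rw [ed] at hd
  rw [e₀] at hn₀
  rw [e₁] at hn₁
  rw [e₂] at hn₂
  rw [el] at hl
  have hz₀ : curvePt a t 0 = n₀ / d := by
    simp [curvePt, hnn₀, ← hdd]; field_simp
  have hz₁ : curvePt a t 1 = n₁ / d := by
    simp [curvePt, hnn₁, ← hdd]; field_simp
  have hz₂ : curvePt a t 2 = n₂ := by
    simp [curvePt, hnn₂, add_comm]
  have hx₀ : curvePt a t 0 - 2 = - (a 2 * t ^ 3 / d) := by simp [curvePt, ← hdd]
  have hx₁ : curvePt a t 1 - 3 = - (a 2 * t ^ 2 / d) := by simp [curvePt, ← hdd]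
  have hx₂ : curvePt a t 2 - 5 = t ^ 2 := by simp [curvePt]
  have hs : a' 0 * -(a 2 * t ^ 3 / d) + a' 1 * -(a 2 * t ^ 2 / d) + a' 2 * t ^ 2
      = t ^ 2 * l / d := by
    field_simp; rw [hll, hdd]; ring
  rw [isCrit_iff, hx₀, hx₁, hx₂, hz₀, hz₁, hz₂, hs]
  obtain ⟨v₀, hv₀⟩ : ∃ v₀, v₀ = u 0 / (n₀ / d) + u 3 * a' 0 / (t ^ 2 * l / d) := ⟨_, rfl⟩
  obtain ⟨v₁, hv₁⟩ : ∃ v₁, v₁ = u 1 / (n₁ / d) + u 3 * a' 1 / (t ^ 2 * l / d) := ⟨_, rfl⟩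
  obtain ⟨v₂, hv₂⟩ : ∃ v₂, v₂ = u 2 / n₂ + u 3 * a' 2 / (t ^ 2 * l / d) := ⟨_, rfl⟩
  have hQ : u 0 * ((2 * a 0 - 3 * a 2 * t ^ 2) * (n₁ * n₂ * t * l * d))
      + u 1 * ((3 * a 0 - 2 * a 2 * t) * (n₀ * n₂ * t * l * d))
      + u 2 * (2 * t * (n₀ * n₁ * t * l * d))
      + u 3 * ((2 * l + (a' 2 * a 0 - a' 0 * a 2) * t) * (n₀ * n₁ * n₂ * d))
      - (u 0 + u 1 + u 3) * (a 0 * (n₀ * n₁ * n₂ * t * l)) =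
      (v₀ * (-a 2 * t ^ 2 * (3 * d - a 0 * t)) + v₁ * (-a 2 * t * (2 * d - a 0 * t))
        + v₂ * (2 * t * d ^ 2)) * (n₀ * n₁ * n₂ * t * l / d) := by
    rw [hv₀, hv₁, hv₂]
    field_simp
    rw [hll, hnn₀, hnn₁, hdd]
    ring
  rw [hQ, mul_eq_zero, or_iff_left (by simp [hn₀, hn₁, hn₂, ht0, hl, hd])]
  constructor
  · rintro ⟨-, -, -, s, rfl, -, lam, mu, h₀, h₁, h₂⟩
    rw [← hv₀] at h₀
    rw [← hv₁] at h₁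
    rw [← hv₂] at h₂
    rw [h₀, h₁, h₂]
    field_simp
    rw [hdd]
    ring
  · intro h
    refine ⟨by simp [hn₀, hn₁, hn₂, hd], ?_, ?_, _, rfl, by simp [ht0, hl, hd],
      -(v₀ * a 1 - v₁ * a 0) / (2 * a 2 * t ^ 3), (v₁ + t * v₀) / d, ?_, ?_, ?_⟩
    · field_simp; ring
    · field_simp; rw [hdd]; ring
    · rw [← hv₀]; field_simp; rw [hdd]; ring
    · rw [← hv₁]; field_simp; rw [hdd]; ring
    · rw [← hv₂]
      have h' : v₂ = a 2 * (v₀ * (t * (3 * d - a 0 * t)) + v₁ * (2 * d - a 0 * t))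
          / (2 * d ^ 2) := by
        field_simp
        apply mul_left_cancel₀ ht0
        linear_combination h
      rw [h']
      field_simp
      rw [hdd]
      ring

theorem exists_param_of_isCrit (ha₁ : a 1 ≠ 0) (ha₂ : a 2 ≠ 0) {z : Fin 3 → ℂ}
    (h : IsCrit a a' u z) : ∃ t, (polePoly a a').eval t ≠ 0 ∧ curvePt a t = z := by
  obtain ⟨⟨hz₀, hz₁, hz₂⟩, hf, hl₁, s, hs, hs0, -⟩ := (isCrit_iff z).mp h
  have hy : z 1 - 3 ≠ 0 := by
    intro hy
    have hx : z 0 - 2 = 0 := by simpa [hy] using hf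
    have hw : z 2 - 5 = 0 := by simpa [hx, hy, ha₂] using hl₁
    exact hs0 (by rw [hs, hx, hy, hw]; ring)
  obtain ⟨t, ht⟩ : ∃ t, t = (z 0 - 2) / (z 1 - 3) := ⟨_, rfl⟩
  have hx : z 0 - 2 = t * (z 1 - 3) := by rw [ht, div_mul_cancel₀ _ hy]
  have hw : z 2 - 5 = t ^ 2 := by
    apply mul_left_cancel₀ (pow_ne_zero 2 hy)
    rw [hx] at hf
    linear_combination -hf
  rw [hx, hw] at hl₁ hs
  have hyd : (z 1 - 3) * (a 0 * t + a 1) = -(a 2 * t ^ 2) := by linear_combination hl₁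
  have ht0 : t ≠ 0 := by
    intro ht0
    rw [ht0] at hyd
    simp [hy, ha₁] at hyd
  have hd : a 0 * t + a 1 ≠ 0 := by
    intro hd
    rw [hd] at hyd
    simp [ha₂, ht0] at hyd
  have hsd : s * (a 0 * t + a 1) = t ^ 2 *
      ((a' 2 * a 0 - a' 0 * a 2) * t + (a' 2 * a 1 - a' 1 * a 2)) := by
    rw [hs]
    linear_combination (a' 0 * t + a' 1) * hyd
  have hn₀ : 2 * (a 0 * t + a 1) - a 2 * t ^ 3 = z 0 * (a 0 * t + a 1) := by
    linear_combination -t * hyd - (a 0 * t + a 1) * hx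
  have hn₁ : 3 * (a 0 * t + a 1) - a 2 * t ^ 2 = z 1 * (a 0 * t + a 1) := by
    linear_combination -hyd
  refine ⟨t, ?_, ?_⟩
  · have hl : (a' 2 * a 0 - a' 0 * a 2) * t + (a' 2 * a 1 - a' 1 * a 2) ≠ 0 := by
      intro hl
      rw [hl, mul_zero] at hsd
      exact mul_ne_zero hs0 hd hsd
    have hn₂ : t ^ 2 + 5 ≠ 0 := by
      rwa [← hw, sub_add_cancel]
    have e₀ : (num₀ a).eval t ≠ 0 := by
      simpa [num₀, den, hn₀] using ⟨hz₀, hd⟩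
    have e₁ : (num₁ a).eval t ≠ 0 := by
      simpa [num₁, den, hn₁] using ⟨hz₁, hd⟩
    have el : (lin a a').eval t ≠ 0 := by simpa [lin] using hl
    simp only [polePoly, Polynomial.eval_mul, mul_ne_zero_iff]
    exact ⟨⟨⟨⟨⟨e₀, e₁⟩, by simpa [num₂] using hn₂⟩, by simpa using ht0⟩, el⟩,
      by simpa [den] using hd⟩
  · have h₁ : a 2 * t ^ 2 / (a 0 * t + a 1) = 3 - z 1 := by
      rw [div_eq_iff hd]
      linear_combination -hn₁
    have h₀ : a 2 * t ^ 3 / (a 0 * t + a 1) = 2 - z 0 := by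
      rw [div_eq_iff hd]
      linear_combination -hn₀
    ext i
    fin_cases i
    · simp [curvePt, h₀]
    · simp [curvePt, h₁]
    · simp [curvePt, ← hw]

theorem curvePt_injOn (ha₂ : a 2 ≠ 0) :
    Set.InjOn (curvePt a) {t | (polePoly a a').eval t ≠ 0} := by
  have key (t : ℂ) (ht : (polePoly a a').eval t ≠ 0) :
      t = (curvePt a t 0 - 2) / (curvePt a t 1 - 3) := by
    have hd : a 0 * t + a 1 ≠ 0 := by
      intro hd
      exact ht (by simp [polePoly, den, hd])
    have ht0 : t ≠ 0 := by
      rintro rfl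
      exact ht (by simp [polePoly])
    simp only [curvePt, Matrix.cons_val_zero, Matrix.cons_val_one, sub_sub_cancel_left]
    generalize a 0 * t + a 1 = d at hd
    field_simp
  intro t ht t' ht' h
  rw [key t ht, key t' ht', h]

theorem ncard_isCrit (ha₁ : a 1 ≠ 0) (ha₂ : a 2 ≠ 0) (hu₀ : u 0 ≠ 0) (hu₁ : u 1 ≠ 0)
    (hu₂ : u 2 ≠ 0) (hu₃ : u 3 ≠ 0) (hu : u 0 + u 1 + u 3 ≠ 0)
    (hpole : (polePoly a a').Separable) (hcrit : (critPoly a a' u).Separable) :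
    {z | IsCrit a a' u z}.ncard = (critPoly a a' u).natDegree := by
  have hne {t : ℂ} (ht : t ∈ (critPoly a a' u).rootSet ℂ) : (polePoly a a').eval t ≠ 0 :=
    eval_polePoly_ne_zero hpole hu₀ hu₁ hu₂ hu₃ hu
      (by simpa using (Polynomial.mem_rootSet.mp ht).2)
  have himage : {z | IsCrit a a' u z} = curvePt a '' (critPoly a a' u).rootSet ℂ := by
    ext z
    constructor
    · intro hz
      obtain ⟨t, ht, rfl⟩ := exists_param_of_isCrit ha₁ ha₂ hz
      refine ⟨t, Polynomial.mem_rootSet.mpr ⟨hcrit.ne_zero, ?_⟩, rfl⟩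
      simpa using (isCrit_curvePt_iff ha₂ ht).mp hz
    · rintro ⟨t, ht, rfl⟩
      exact (isCrit_curvePt_iff ha₂ (hne ht)).mpr
        (by simpa using (Polynomial.mem_rootSet.mp ht).2)
  rw [himage, ((curvePt_injOn ha₂).mono fun _ => hne).ncard_image,
    ← Nat.card_coe_set_eq, Nat.card_eq_fintype_card,
    Polynomial.card_rootSet_eq_natDegree hcrit (IsAlgClosed.splits _)]

end UmbrellaSection

open UmbrellaSection

/-- **The second removal ML degree of the shifted Whitney umbrella with respect to the
point `P = (2,3,5)` of its singular line is `r₂(P,X) = 9`.**  For generic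
`(a, a', u) ∈ ℂ³ × ℂ³ × ℂ⁴`, writing `ℓ₁(z) = Σᵢ aᵢ(zᵢ − Pᵢ)` and
`ℓ₂(z) = Σᵢ a'ᵢ(zᵢ − Pᵢ)`, there are exactly `9` ML-critical points of the umbrella
on the hyperplane section `ℓ₁ = 0` with the hyperplane `ℓ₂` removed. -/
theorem umbrella_removal_ml_degree_two_pinch :
    ∃ G : MvPolynomial (Fin 3 ⊕ Fin 3 ⊕ Fin 4) ℂ, G ≠ 0 ∧
      ∀ (a a' : Fin 3 → ℂ) (u : Fin 4 → ℂ), eval (Sum.elim a (Sum.elim a' u)) G ≠ 0 →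
        {z : Fin 3 → ℂ | (∀ i, z i ≠ 0) ∧ eval z umbrella = 0 ∧
            (∑ i, a i * (z i - pinchPt i)) = 0 ∧
            (∑ i, a' i * (z i - pinchPt i)) ≠ 0 ∧
            ∃ lam mu : ℂ, ∀ i : Fin 3,
              u i.castSucc / z i + u 3 * a' i / (∑ j, a' j * (z j - pinchPt j))
                = lam * eval z (pderiv i umbrella) + mu * a i}.ncard = 9 := by
  let A : Fin 3 → MvPolynomial (Fin 3 ⊕ Fin 3 ⊕ Fin 4) ℂ := fun i => X (.inl i)
  let A' : Fin 3 → MvPolynomial (Fin 3 ⊕ Fin 3 ⊕ Fin 4) ℂ := fun i => X (.inr (.inl i))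
  let U : Fin 4 → MvPolynomial (Fin 3 ⊕ Fin 3 ⊕ Fin 4) ℂ := fun i => X (.inr (.inr i))
  have hA (a a' : Fin 3 → ℂ) (u : Fin 4 → ℂ) : eval (Sum.elim a (Sum.elim a' u)) ∘ A = a := by
    ext i; simp [A]
  have hA' (a a' : Fin 3 → ℂ) (u : Fin 4 → ℂ) : eval (Sum.elim a (Sum.elim a' u)) ∘ A' = a' := by
    ext i; simp [A']
  have hU (a a' : Fin 3 → ℂ) (u : Fin 4 → ℂ) : eval (Sum.elim a (Sum.elim a' u)) ∘ U = u := by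
    ext i; simp [U]
  have hpole (a a' : Fin 3 → ℂ) (u : Fin 4 → ℂ) :
      (polePoly A A').map (eval (Sum.elim a (Sum.elim a' u))) = polePoly a a' := by
    rw [map_polePoly, hA, hA']
  have hcrit (a a' : Fin 3 → ℂ) (u : Fin 4 → ℂ) :
      (critPoly A A' U).map (eval (Sum.elim a (Sum.elim a' u))) = critPoly a a' u := by
    rw [map_critPoly, hA, hA', hU]
  obtain ⟨G₁, hG₁, H₁⟩ := exists_generic_separable (polePoly A A') 10
    (natDegree_polePoly_le _ _) (by norm_num) (Sum.elim testA (Sum.elim testA' testU))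
    (by rw [hpole]; exact natDegree_polePoly_test) (by rw [hpole]; exact separable_polePoly_test)
  obtain ⟨G₂, hG₂, H₂⟩ := exists_generic_separable (critPoly A A' U) 9
    (natDegree_critPoly_le _ _ _) (by norm_num) (Sum.elim testA (Sum.elim testA' testU))
    (by rw [hcrit]; exact natDegree_critPoly_test) (by rw [hcrit]; exact separable_critPoly_test)
  have hsum : U 0 + U 1 + U 3 ≠ 0 := fun h => by
    simpa [U] using congrArg (eval (Sum.elim testA (Sum.elim testA' ![1, 0, 0, 0]))) h
  refine ⟨G₁ * G₂ * (A 1 * A 2) * (U 0 * U 1 * U 2 * U 3) * (U 0 + U 1 + U 3), ?_, ?_⟩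
  · simp [hG₁, hG₂, hsum, A, U]
  · intro a a' u h
    simp only [map_mul, map_add, mul_ne_zero_iff] at h
    obtain ⟨⟨⟨⟨h₁, h₂⟩, ha₁, ha₂⟩, ⟨⟨hu₀, hu₁⟩, hu₂⟩, hu₃⟩, hu⟩ := h
    simp only [A, U, eval_X, Sum.elim_inl, Sum.elim_inr] at ha₁ ha₂ hu₀ hu₁ hu₂ hu₃ hu
    have hp := (H₁ _ h₁).2
    have hc := H₂ _ h₂
    rw [hpole] at hp
    rw [hcrit] at hc
    exact (ncard_isCrit ha₁ ha₂ hu₀ hu₁ hu₂ hu₃ hu hp hc.2).trans hc.1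
end

section
/- Let f := (z₁ − 2)² − (z₂ − 3)²(z₃ − 5) ∈ ℂ[z₁,z₂,z₃] and let P := (2, 3, 5). For generic (a, a') ∈ ℂ³ × ℂ³, the set {z ∈ (ℂ*)³ : f(z) = 0, Σ_i a_i(z_i − P_i) = 0, Σ_i a'_i(z_i − P_i) = 0, and z ≠ P} has exactly 1 element. (The third removal ML degree of the shifted Whitney umbrella with respect to P = (2,3,5) is r₃(P,X) = 1; equivalently, two general hyperplanes through P meet the degree-3 surface residually in a single torus point, reflecting that the surface has multiplicity 2 at P.) -/
open MvPolynomial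

/-- A vector annihilated by two linear forms is a multiple of their cross product `d`, provided
the first coordinate of `d` is nonzero. -/
theorem exists_smul_crossProduct_of_sum_eq_zero {a a' w : Fin 3 → ℂ}
    (hd : crossProduct a a' 0 ≠ 0) (h : ∑ i, a i * w i = 0) (h' : ∑ i, a' i * w i = 0) :
    ∃ s : ℂ, w = s • crossProduct a a' := by
  simp only [Fin.sum_univ_three] at h h'
  simp only [cross_apply, Matrix.cons_val_zero] at hd
  refine ⟨w 0 / (a 1 * a' 2 - a 2 * a' 1), ?_⟩
  ext i
  fin_cases i <;> simp [cross_apply] <;> field_simp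
  · linear_combination a' 2 * h - a 2 * h'
  · linear_combination a 1 * h' - a' 1 * h

theorem eval_umbrella_pinchPt_add_smul (s : ℂ) (d : Fin 3 → ℂ) :
    eval (pinchPt + s • d) umbrella = s ^ 2 * (d 0 ^ 2 - s * (d 1 ^ 2 * d 2)) := by
  simp [umbrella, pinchPt, Matrix.vecHead, Matrix.vecTail]
  ring

/-- A line through the pinch point with direction `d` meets the umbrella in exactly one further
torus point, as long as `d` avoids the listed hypersurfaces. -/
theorem torus_umbrella_line_eq_singleton {d : Fin 3 → ℂ} (h0 : d 0 ≠ 0) (h1 : d 1 ≠ 0)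
    (h2 : d 2 ≠ 0) (k0 : 2 * (d 1 ^ 2 * d 2) + d 0 ^ 3 ≠ 0) (k1 : 3 * (d 1 * d 2) + d 0 ^ 2 ≠ 0)
    (k2 : 5 * d 1 ^ 2 + d 0 ^ 2 ≠ 0) :
    {z : Fin 3 → ℂ | (∀ i, z i ≠ 0) ∧ eval z umbrella = 0 ∧ (∃ s : ℂ, z = pinchPt + s • d) ∧
      z ≠ pinchPt} = {pinchPt + (d 0 ^ 2 / (d 1 ^ 2 * d 2)) • d} := by
  ext z
  simp only [Set.mem_ofPred_eq, Set.mem_singleton_iff]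
  constructor
  · rintro ⟨-, hf, ⟨s, rfl⟩, hne⟩
    have hs : s ≠ 0 := by
      rintro rfl
      simp at hne
    rw [eval_umbrella_pinchPt_add_smul] at hf
    have hs' : s = d 0 ^ 2 / (d 1 ^ 2 * d 2) := by
      rw [eq_div_iff (by positivity)]
      have := (mul_eq_zero.mp hf).resolve_left (pow_ne_zero 2 hs)
      linear_combination -this
    rw [hs']
  · rintro rfl
    refine ⟨fun i => ?_, ?_, ⟨_, rfl⟩, fun h => ?_⟩
    · fin_cases i <;> simp [pinchPt] <;> field_simp
      · exact fun h => k0 (by linear_combination h)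
      · exact fun h => k1 (by linear_combination h)
      · exact fun h => k2 (by linear_combination h)
    · rw [eval_umbrella_pinchPt_add_smul]
      field_simp
      ring
    · have := congrFun h 0
      simp [h0, h1, h2] at this

/-- **The third removal ML degree of the shifted Whitney umbrella with respect to
`P = (2,3,5)` is `r₃(P,X) = 1`**: two general hyperplanes through `P` meet the surface
residually in exactly one torus point besides `P`. -/
theorem umbrella_removal_ml_degree_three_pinch :
    ∃ G : MvPolynomial (Fin 3 ⊕ Fin 3) ℂ, G ≠ 0 ∧
      ∀ (a a' : Fin 3 → ℂ), eval (Sum.elim a a') G ≠ 0 →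
        {z : Fin 3 → ℂ | (∀ i, z i ≠ 0) ∧ eval z umbrella = 0 ∧
            (∑ i, a i * (z i - pinchPt i)) = 0 ∧
            (∑ i, a' i * (z i - pinchPt i)) = 0 ∧ z ≠ pinchPt}.ncard = 1 := by
  let A : Fin 3 → MvPolynomial (Fin 3 ⊕ Fin 3) ℂ := fun i => X (Sum.inl i)
  let A' : Fin 3 → MvPolynomial (Fin 3 ⊕ Fin 3) ℂ := fun i => X (Sum.inr i)
  let D := crossProduct A A'
  have hD (a a' : Fin 3 → ℂ) (i : Fin 3) :
      eval (Sum.elim a a') (D i) = crossProduct a a' i := by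
    fin_cases i <;> simp [D, A, A', cross_apply]
  let G := D 0 * D 1 * D 2 * (2 * (D 1 ^ 2 * D 2) + D 0 ^ 3) * (3 * (D 1 * D 2) + D 0 ^ 2) *
    (5 * D 1 ^ 2 + D 0 ^ 2)
  refine ⟨G, fun hG => ?_, fun a a' hG => ?_⟩
  · have := congrArg (eval (Sum.elim ![1, -1, 0] ![0, 1, -1])) hG
    simp [G, hD, cross_apply] at this
    norm_num at this
  · simp only [G, map_mul, map_add, map_pow, map_ofNat, hD, mul_ne_zero_iff] at hG
    obtain ⟨⟨⟨⟨⟨h0, h1⟩, h2⟩, k0⟩, k1⟩, k2⟩ := hG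
    rw [Set.ncard_eq_one]
    refine ⟨_, Eq.trans ?_ (torus_umbrella_line_eq_singleton h0 h1 h2 k0 k1 k2)⟩
    ext z
    simp only [Set.mem_ofPred_eq]
    constructor
    · rintro ⟨hz, hf, h, h', hne⟩
      obtain ⟨s, hs⟩ := exists_smul_crossProduct_of_sum_eq_zero (w := z - pinchPt) h0 h h'
      exact ⟨hz, hf, ⟨s, by rw [← hs]; abel⟩, hne⟩
    · rintro ⟨hz, hf, ⟨s, rfl⟩, hne⟩
      refine ⟨hz, hf, ?_, ?_, hne⟩ <;> simp [Fin.sum_univ_three, cross_apply] <;> ring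
end

section
/- Let f := (z₁ − 2)² − (z₂ − 3)²(z₃ − 5) ∈ ℂ[z₁,z₂,z₃]. There is a finite subset S ⊂ ℂ such that for every t ∈ ℂ with t ∉ S ∪ {0, 5}, setting P := (2, 3, t) (a point of the singular line of V(f) in the torus, other than the pinch point), for generic (a, a') ∈ ℂ³ × ℂ³ the set {z ∈ (ℂ*)³ : f(z) = 0, Σ_i a_i(z_i − P_i) = 0, Σ_i a'_i(z_i − P_i) = 0, and z ≠ P} has exactly 1 element. (The third removal ML degree of the shifted Whitney umbrella with respect to a general point of its singular line is r₃ = 1.) -/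
open MvPolynomial

/-- A vector annihilated by two linear forms is parallel to their cross product. -/
lemma cross_parallel {a a' w : Fin 3 → ℂ}
    (h : a 0 * w 0 + a 1 * w 1 + a 2 * w 2 = 0)
    (h' : a' 0 * w 0 + a' 1 * w 1 + a' 2 * w 2 = 0) :
    w 0 * (a 0 * a' 1 - a 1 * a' 0) = w 2 * (a 1 * a' 2 - a 2 * a' 1) ∧
      w 1 * (a 0 * a' 1 - a 1 * a' 0) = w 2 * (a 2 * a' 0 - a 0 * a' 2) := by
  constructor
  · linear_combination a' 1 * h - a 1 * h'
  · linear_combination a 0 * h' - a' 0 * h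

/-- On the line `P + s d` through `P = (2, 3, t)`, the umbrella equation has exactly one solution
other than `P`, at `s = (d₀² - d₁² (t - 5)) / (d₁² d₂)`. -/
lemma umbrella_line_unique {t d₀ d₁ d₂ w₀ w₁ w₂ : ℂ} (h₁ : d₁ ≠ 0) (h₂ : d₂ ≠ 0)
    (hw₀ : w₀ * d₂ = w₂ * d₀) (hw₁ : w₁ * d₂ = w₂ * d₁)
    (hf : w₀ ^ 2 - w₁ ^ 2 * (w₂ + t - 5) = 0) (hw : ¬ (w₀ = 0 ∧ w₁ = 0 ∧ w₂ = 0)) :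
    w₀ = (d₀ ^ 2 - d₁ ^ 2 * (t - 5)) / (d₁ ^ 2 * d₂) * d₀ ∧
      w₁ = (d₀ ^ 2 - d₁ ^ 2 * (t - 5)) / (d₁ ^ 2 * d₂) * d₁ ∧
      w₂ = (d₀ ^ 2 - d₁ ^ 2 * (t - 5)) / (d₁ ^ 2 * d₂) * d₂ := by
  have hw₂ : w₂ ≠ 0 := by
    rintro rfl
    simp_all
  have e₀ : w₀ = w₂ * d₀ / d₂ := by rw [eq_div_iff h₂, hw₀]
  have e₁ : w₁ = w₂ * d₁ / d₂ := by rw [eq_div_iff h₂, hw₁]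
  have key : w₂ * d₁ ^ 2 = d₀ ^ 2 - d₁ ^ 2 * (t - 5) := by
    rw [e₀, e₁] at hf
    field_simp at hf
    refine mul_left_cancel₀ (pow_ne_zero 2 hw₂) ?_
    linear_combination -hf
  have e₂ : w₂ = (d₀ ^ 2 - d₁ ^ 2 * (t - 5)) / (d₁ ^ 2 * d₂) * d₂ := by
    rw [← key]
    field_simp
  refine ⟨?_, ?_, e₂⟩
  · rw [e₀, ← key]
    field_simp
  · rw [e₁, ← key]
    field_simp

/-- **The third removal ML degree of the shifted Whitney umbrella with respect to a
general point of its singular line is `r₃ = 1`.**  There is a finite set `S ⊂ ℂ` such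
that for every `t ∉ S ∪ {0, 5}`, setting `P = (2, 3, t)`, for generic `(a, a')` the two
hyperplanes `Σᵢ aᵢ(zᵢ − Pᵢ) = 0` and `Σᵢ a'ᵢ(zᵢ − Pᵢ) = 0` meet the surface in exactly
one torus point besides `P`. -/
theorem umbrella_removal_ml_degree_three_general :
    ∃ S : Set ℂ, S.Finite ∧
      ∀ t : ℂ, t ∉ S → t ≠ 0 → t ≠ 5 →
        ∃ G : MvPolynomial (Fin 3 ⊕ Fin 3) ℂ, G ≠ 0 ∧
          ∀ (a a' : Fin 3 → ℂ), eval (Sum.elim a a') G ≠ 0 →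
            {z : Fin 3 → ℂ | (∀ i, z i ≠ 0) ∧ eval z umbrella = 0 ∧
                (∑ i, a i * (z i - (![2, 3, t] : Fin 3 → ℂ) i)) = 0 ∧
                (∑ i, a' i * (z i - (![2, 3, t] : Fin 3 → ℂ) i)) = 0 ∧
                z ≠ ![2, 3, t]}.ncard = 1 := by
  refine ⟨∅, Set.finite_empty, fun t _ _ ht5 => ?_⟩
  let x : Fin 3 → MvPolynomial (Fin 3 ⊕ Fin 3) ℂ := fun i => X (Sum.inl i)
  let y : Fin 3 → MvPolynomial (Fin 3 ⊕ Fin 3) ℂ := fun i => X (Sum.inr i)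
  let D₀ := x 1 * y 2 - x 2 * y 1
  let D₁ := x 2 * y 0 - x 0 * y 2
  let D₂ := x 0 * y 1 - x 1 * y 0
  let N := D₀ ^ 2 - D₁ ^ 2 * C (t - 5)
  refine ⟨(D₁ * D₂ * N * (C 2 * D₁ ^ 2 * D₂ + N * D₀) * (C 5 * D₁ ^ 2 + D₀ ^ 2)) *
    (C 3 * D₁ * D₂ + N), mul_ne_zero ?_ ?_, ?_⟩
  · intro h
    have := congrArg (eval (Sum.elim ![1, 0, 0] ![0, 1, -1])) h
    simp [x, y, D₀, D₁, D₂, N, sub_eq_zero, ht5.symm] at this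
  · intro h
    have := congrArg (eval (Sum.elim ![1, 0, -1] ![0, 1, 0])) h
    simp [x, y, D₀, D₁, D₂, N] at this
  intro a a' hG
  obtain ⟨d₀, hd₀⟩ : ∃ d, d = a 1 * a' 2 - a 2 * a' 1 := ⟨_, rfl⟩
  obtain ⟨d₁, hd₁⟩ : ∃ d, d = a 2 * a' 0 - a 0 * a' 2 := ⟨_, rfl⟩
  obtain ⟨d₂, hd₂⟩ : ∃ d, d = a 0 * a' 1 - a 1 * a' 0 := ⟨_, rfl⟩
  simp only [x, y, D₀, D₁, D₂, N, map_mul, map_add, map_sub, map_pow, eval_X, eval_C,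
    Sum.elim_inl, Sum.elim_inr, ← hd₀, ← hd₁, ← hd₂, mul_ne_zero_iff] at hG
  obtain ⟨⟨⟨⟨⟨h₁, h₂⟩, hN⟩, hz₀⟩, hz₂⟩, hz₁⟩ := hG
  obtain ⟨s, hs⟩ : ∃ s, s = (d₀ ^ 2 - d₁ ^ 2 * (t - 5)) / (d₁ ^ 2 * d₂) := ⟨_, rfl⟩
  have hs' : s * (d₁ ^ 2 * d₂) = d₀ ^ 2 - d₁ ^ 2 * (t - 5) := by
    rw [hs]
    field_simp
  have hs0 : s ≠ 0 := by
    rintro rfl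
    exact hN (by rw [← hs', zero_mul])
  rw [Set.ncard_eq_one]
  refine ⟨![2 + s * d₀, 3 + s * d₁, t + s * d₂], ?_⟩
  ext z
  simp only [Set.mem_ofPred_eq, Set.mem_singleton_iff, Fin.sum_univ_three, umbrella, map_sub,
    map_mul, map_pow, eval_X, map_ofNat, Matrix.cons_val]
  constructor
  · rintro ⟨-, hf, ha, ha', hP⟩
    obtain ⟨hw₀, hw₁⟩ := cross_parallel (w := ![z 0 - 2, z 1 - 3, z 2 - t]) ha ha'
    rw [← hd₂, ← hd₀] at hw₀
    rw [← hd₂, ← hd₁] at hw₁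
    obtain ⟨r₀, r₁, r₂⟩ := umbrella_line_unique (t := t) h₁ h₂ hw₀ hw₁
      (by simp only [Matrix.cons_val]; linear_combination hf)
      (by
        rintro ⟨k₀, k₁, k₂⟩
        apply hP
        ext i
        fin_cases i
        · exact sub_eq_zero.mp k₀
        · exact sub_eq_zero.mp k₁
        · exact sub_eq_zero.mp k₂)
    rw [← hs] at r₀ r₁ r₂
    simp only [Matrix.cons_val] at r₀ r₁ r₂
    ext i
    fin_cases i
    · exact sub_eq_iff_eq_add'.mp r₀
    · exact sub_eq_iff_eq_add'.mp r₁
    · exact sub_eq_iff_eq_add'.mp r₂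
  · rintro rfl
    simp only [Matrix.cons_val]
    refine ⟨?_, ?_, ?_, ?_, ?_⟩
    · intro i
      fin_cases i
      · intro h
        change 2 + s * d₀ = 0 at h
        exact hz₀ (by linear_combination d₁ ^ 2 * d₂ * h - d₀ * hs')
      · intro h
        change 3 + s * d₁ = 0 at h
        exact hz₁ (by linear_combination d₁ * d₂ * h - hs')
      · intro h
        change t + s * d₂ = 0 at h
        exact hz₂ (by linear_combination d₁ ^ 2 * h - hs')
    · linear_combination -s ^ 2 * hs'
    · rw [hd₀, hd₁, hd₂]
      ring
    · rw [hd₀, hd₁, hd₂]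
      ring
    · intro h
      have h' : t + s * d₂ = t := congrFun h 2
      simp [hs0, h₂] at h'
end

section
/- Let h ∈ ℂ[z₁,…,z₅] be the determinant of the Hankel matrix [[12z₁, 3z₂, 2z₃], [3z₂, 2z₃, 3z₄], [2z₃, 3z₄, 12z₅]] and let ℓ := z₁ + z₂ + z₃ + z₄ + z₅ − 1. For generic u ∈ ℂ⁵, the set {z ∈ (ℂ*)⁵ : h(z) = 0, ℓ(z) = 0, and there exist λ, μ ∈ ℂ with u_i = λ·z_i·(∂h/∂z_i)(z) + μ·z_i for i = 1,…,5} has exactly 12 elements. (The ML degree of the Hankel determinantal hypersurface sliced by z₁+⋯+z₅ = 1 is r₀ = 12.) -/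
open MvPolynomial

/-- The determinant of the Hankel matrix
`[[12z₁, 3z₂, 2z₃], [3z₂, 2z₃, 3z₄], [2z₃, 3z₄, 12z₅]]`. -/
noncomputable def hankelDet : MvPolynomial (Fin 5) ℂ :=
  Matrix.det !![12 * X 0, 3 * X 1, 2 * X 2;
                 3 * X 1, 2 * X 2, 3 * X 3;
                 2 * X 2, 3 * X 3, 12 * X 4]

namespace HankelML

section Elimination

variable {S : Type*} [CommRing S]

/-- The determinant of the `3 × 3` Bezout matrix of the cubics `∑ dᵢ Dⁱ` and `∑ eᵢ Dⁱ`. -/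
def bezoutDet (d e : Fin 4 → S) : S :=
  let k (i j : Fin 4) : S := d i * e j - d j * e i
  k 3 2 * (k 3 0 + k 2 1) * k 1 0 + 2 * k 3 1 * k 3 0 * k 2 0 - k 3 2 * k 2 0 ^ 2
    - (k 3 0 + k 2 1) * k 3 0 ^ 2 - k 1 0 * k 3 1 ^ 2

/-- The value at `x` of the cubic with coefficients `d`. -/
def cubic (d : Fin 4 → S) (x : S) : S := d 0 + d 1 * x + d 2 * x ^ 2 + d 3 * x ^ 3

lemma bezoutDet_eq_zero_of_common_root {d e : Fin 4 → S} {x : S} (hd : cubic d x = 0)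
    (he : cubic e x = 0) : bezoutDet d e = 0 := by
  have hd0 : d 0 = -(d 1 * x + d 2 * x ^ 2 + d 3 * x ^ 3) := by
    unfold cubic at hd; linear_combination hd
  have he0 : e 0 = -(e 1 * x + e 2 * x ^ 2 + e 3 * x ^ 3) := by
    unfold cubic at he; linear_combination he
  simp only [bezoutDet, hd0, he0]
  ring

lemma exists_common_root_of_bezoutDet_eq_zero {K : Type*} [Field K] [IsAlgClosed K]
    {d e : Fin 4 → K} (he : e 3 ≠ 0) (h : bezoutDet d e = 0) :
    ∃ x, cubic d x = 0 ∧ cubic e x = 0 := by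
  obtain ⟨x, hx⟩ : ∃ x, cubic e x = 0 := by
    have hdeg : (Polynomial.C (e 3) * Polynomial.X ^ 3 + Polynomial.C (e 2) * Polynomial.X ^ 2
        + Polynomial.C (e 1) * Polynomial.X + Polynomial.C (e 0)).degree = 3 :=
      Polynomial.degree_cubic he
    obtain ⟨x, hx⟩ := IsAlgClosed.exists_root _ (by rw [hdeg]; norm_num)
    refine ⟨x, ?_⟩
    simp only [Polynomial.IsRoot, Polynomial.eval_add, Polynomial.eval_mul, Polynomial.eval_C,
      Polynomial.eval_pow, Polynomial.eval_X] at hx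
    unfold cubic
    linear_combination hx
  obtain ⟨y, hy⟩ : ∃ y, e 3 * y ^ 2 + (e 2 + e 3 * x) * y + (e 1 + e 2 * x + e 3 * x ^ 2) = 0 := by
    have hdeg : (Polynomial.C (e 3) * Polynomial.X ^ 2 + Polynomial.C (e 2 + e 3 * x) * Polynomial.X
        + Polynomial.C (e 1 + e 2 * x + e 3 * x ^ 2)).degree = 2 :=
      Polynomial.degree_quadratic he
    obtain ⟨y, hy⟩ := IsAlgClosed.exists_root _ (by rw [hdeg]; norm_num)
    refine ⟨y, ?_⟩
    simpa only [Polynomial.IsRoot, Polynomial.eval_add, Polynomial.eval_mul, Polynomial.eval_C,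
      Polynomial.eval_pow, Polynomial.eval_X] using hy
  obtain ⟨w, hw⟩ : ∃ w, e 2 = -e 3 * (x + y + w) :=
    ⟨-(e 2 / e 3) - x - y, by field_simp; ring⟩
  have h1 : e 1 = e 3 * (x * y + x * w + y * w) := by
    rw [hw] at hy; linear_combination hy
  have h0 : e 0 = -e 3 * (x * y * w) := by
    unfold cubic at hx; rw [hw, h1] at hx; linear_combination hx
  have hprod : e 3 ^ 3 * (cubic d x * cubic d y * cubic d w) = 0 := by
    rw [← h]
    simp only [bezoutDet, cubic, h0, h1, hw]
    ring
  have hcub : ∀ v, cubic e v = e 3 * (v - x) * (v - y) * (v - w) := by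
    intro v; simp only [cubic, h0, h1, hw]; ring
  rcases mul_eq_zero.1 ((mul_eq_zero.1 hprod).resolve_left (pow_ne_zero 3 he)) with h' | h'
  · rcases mul_eq_zero.1 h' with h' | h'
    · exact ⟨x, h', by rw [hcub]; ring⟩
    · exact ⟨y, h', by rw [hcub]; ring⟩
  · exact ⟨w, h', by rw [hcub]; ring⟩

/-- If two families of cubics acquire two common roots at `x₀`, the Bezout determinant of the
families vanishes there to order at least two. -/
lemma eval_derivative_bezoutDet_eq_zero {K : Type*} [Field K]
    (d e : Fin 4 → Polynomial K) {x₀ x y : K} (hxy : x ≠ y)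
    (hdx : cubic (fun i => (d i).eval x₀) x = 0) (hex : cubic (fun i => (e i).eval x₀) x = 0)
    (hdy : cubic (fun i => (d i).eval x₀) y = 0) (hey : cubic (fun i => (e i).eval x₀) y = 0) :
    (bezoutDet d e).derivative.eval x₀ = 0 := by
  have key : ∀ c : Fin 4 → K, cubic c x = 0 → cubic c y = 0 →
      ∃ r, c 0 = x * y * r ∧ c 1 = c 3 * x * y - (x + y) * r ∧ c 2 = r - c 3 * (x + y) := by
    intro c hx hy
    unfold cubic at hx hy
    have h1 : c 1 + c 2 * (x + y) + c 3 * (x ^ 2 + x * y + y ^ 2) = 0 := by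
      refine (mul_eq_zero.1 ?_).resolve_left (sub_ne_zero.2 hxy)
      linear_combination hx - hy
    refine ⟨c 2 + c 3 * (x + y), ?_, ?_, ?_⟩
    · linear_combination hx - x * h1
    · linear_combination h1
    · ring
  obtain ⟨r, h0, h1, h2⟩ := key _ hdx hdy
  obtain ⟨t, g0, g1, g2⟩ := key _ hex hey
  simp only [bezoutDet, Polynomial.derivative_sub, Polynomial.derivative_add,
    Polynomial.derivative_mul, Polynomial.derivative_pow, Polynomial.eval_sub, Polynomial.eval_add,
    Polynomial.eval_mul, Polynomial.eval_pow, h0, h1, h2, g0, g1, g2, Polynomial.derivative_ofNat,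
    Polynomial.eval_zero, Polynomial.eval_ofNat, Polynomial.eval_C]
  push_cast
  ring

end Elimination

section Resolvent

variable {S : Type*} [CommRing S]

/-- The coefficients, with respect to the second central moment, of the first of the two equations
satisfied by the critical points. -/
def coefFst (s p e α β γ y : S) : Fin 4 → S :=
  ![y ^ 2 * (γ - 2 * e * β) - 6 * p * e * α * y - 6 * p ^ 2 * α,
    4 * (γ - 2 * e * β) + s * (2 * e * y ^ 3 - y ^ 4) + α * (6 * e ^ 2 - 12 * p - 6 * e * y)
      + s * (6 * p ^ 2 + 6 * p * e * y),
    s * (8 * e * y - 5 * y ^ 2) - 6 * α - s * (6 * e ^ 2 - 12 * p - 6 * e * y),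
    2 * s]

/-- The coefficients, with respect to the second central moment, of the second of the two equations
satisfied by the critical points. -/
def coefSnd (s p e α β γ y : S) : Fin 4 → S :=
  ![p * y * (γ - 2 * e * β) + 2 * p ^ 2 * β - 6 * p ^ 2 * e * α,
    (12 * p * e - 6 * e ^ 3 + (12 * e ^ 2 - 6 * p) * y - 6 * e * y ^ 2) * α + 6 * p ^ 2 * e * s
      + (6 * e ^ 2 - 4 * p - 6 * e * y + 2 * y ^ 2) * β - s * (2 * p ^ 2 * y - 2 * p * e * y ^ 2)
      + (y - 2 * e) * γ - s * p * y ^ 3,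
    (6 * e - 6 * y) * α - s * (12 * p * e - 6 * e ^ 3 + (12 * e ^ 2 - 6 * p) * y - 6 * e * y ^ 2)
      + 2 * β - s * (6 * e ^ 2 * y - 4 * p * y - 6 * e * y ^ 2 + 2 * y ^ 3)
      - s * (y ^ 3 - 2 * e * y ^ 2) - s * p * y,
    s * (3 * y - 4 * e)]

/-- `coefFst` as a function of the parameters `t = (b, c, α, β, γ)`. -/
def eqFst (t : Fin 5 → S) (y : S) : Fin 4 → S :=
  coefFst (t 0 + t 1) (t 0 * t 1) (t 0 - t 1) (t 2) (t 3) (t 4) y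

/-- `coefSnd` as a function of the parameters `t = (b, c, α, β, γ)`. -/
def eqSnd (t : Fin 5 → S) (y : S) : Fin 4 → S :=
  coefSnd (t 0 + t 1) (t 0 * t 1) (t 0 - t 1) (t 2) (t 3) (t 4) y

/-- The resolvent polynomial whose roots parametrize the critical points. -/
noncomputable def resolvent (t : Fin 5 → S) : Polynomial S :=
  bezoutDet (eqSnd (fun i => Polynomial.C (t i)) Polynomial.X)
    (eqFst (fun i => Polynomial.C (t i)) Polynomial.X)

lemma map_eqFst {T : Type*} [CommRing T] (φ : S →+* T) (t : Fin 5 → S) (y : S) (i : Fin 4) :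
    φ (eqFst t y i) = eqFst (fun j => φ (t j)) (φ y) i := by
  fin_cases i <;> simp [eqFst, coefFst, map_ofNat]

lemma map_eqSnd {T : Type*} [CommRing T] (φ : S →+* T) (t : Fin 5 → S) (y : S) (i : Fin 4) :
    φ (eqSnd t y i) = eqSnd (fun j => φ (t j)) (φ y) i := by
  fin_cases i <;> simp [eqSnd, coefSnd, map_ofNat]

lemma map_bezoutDet {T : Type*} [CommRing T] (φ : S →+* T) (d e : Fin 4 → S) :
    φ (bezoutDet d e) = bezoutDet (fun i => φ (d i)) (fun i => φ (e i)) := by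
  simp [bezoutDet, map_ofNat]

lemma eval_eqFst (t : Fin 5 → S) (y : S) (i : Fin 4) :
    (eqFst (fun i => Polynomial.C (t i)) Polynomial.X i).eval y = eqFst t y i := by
  simpa using map_eqFst (Polynomial.evalRingHom y) (fun i => Polynomial.C (t i)) Polynomial.X i

lemma eval_eqSnd (t : Fin 5 → S) (y : S) (i : Fin 4) :
    (eqSnd (fun i => Polynomial.C (t i)) Polynomial.X i).eval y = eqSnd t y i := by
  simpa using map_eqSnd (Polynomial.evalRingHom y) (fun i => Polynomial.C (t i)) Polynomial.X i

lemma eval_resolvent (t : Fin 5 → S) (y : S) :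
    (resolvent t).eval y = bezoutDet (eqSnd t y) (eqFst t y) := by
  have h := map_bezoutDet (Polynomial.evalRingHom y)
    (eqSnd (fun i => Polynomial.C (t i)) Polynomial.X)
    (eqFst (fun i => Polynomial.C (t i)) Polynomial.X)
  simp only [Polynomial.coe_evalRingHom, eval_eqFst, eval_eqSnd] at h
  exact h

lemma map_resolvent {T : Type*} [CommRing T] (φ : S →+* T) (t : Fin 5 → S) :
    (resolvent t).map φ = resolvent (fun i => φ (t i)) := by
  have h := map_bezoutDet (Polynomial.mapRingHom φ)
    (eqSnd (fun i => Polynomial.C (t i)) Polynomial.X)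
    (eqFst (fun i => Polynomial.C (t i)) Polynomial.X)
  simp only [map_eqFst, map_eqSnd, Polynomial.coe_mapRingHom, Polynomial.map_C,
    Polynomial.map_X] at h
  exact h

section Degree

open Polynomial

lemma natDegree_bezoutDet_le {d e : Fin 4 → S[X]}
    (h32 : (d 3 * e 2 - d 2 * e 3).natDegree ≤ 3) (h31 : (d 3 * e 1 - d 1 * e 3).natDegree ≤ 5)
    (h30 : (d 3 * e 0 - d 0 * e 3).natDegree ≤ 3) (h21 : (d 2 * e 1 - d 1 * e 2).natDegree ≤ 7)
    (h20 : (d 2 * e 0 - d 0 * e 2).natDegree ≤ 5) (h10 : (d 1 * e 0 - d 0 * e 1).natDegree ≤ 4) :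
    (bezoutDet d e).natDegree ≤ 14 := by
  unfold bezoutDet
  simp only
  generalize d 3 * e 2 - d 2 * e 3 = a at *
  generalize d 3 * e 1 - d 1 * e 3 = b at *
  generalize d 3 * e 0 - d 0 * e 3 = c at *
  generalize d 2 * e 1 - d 1 * e 2 = k at *
  generalize d 2 * e 0 - d 0 * e 2 = l at *
  generalize d 1 * e 0 - d 0 * e 1 = m at *
  have hck : (c + k).natDegree ≤ 7 := natDegree_add_le_of_degree_le (h30.trans (by norm_num)) h21
  have h1 : (a * (c + k) * m).natDegree ≤ 14 :=
    natDegree_mul_le_of_le (natDegree_mul_le_of_le h32 hck) h10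
  have h2 : (2 * b * c * l).natDegree ≤ 14 :=
    (natDegree_mul_le_of_le (natDegree_mul_le_of_le (natDegree_mul_le_of_le
      (natDegree_ofNat 2).le h31) h30) h20).trans (by norm_num)
  have h3 : (a * l ^ 2).natDegree ≤ 14 :=
    (natDegree_mul_le_of_le h32 (natDegree_pow_le_of_le 2 h20)).trans (by norm_num)
  have h4 : ((c + k) * c ^ 2).natDegree ≤ 14 :=
    (natDegree_mul_le_of_le hck (natDegree_pow_le_of_le 2 h30)).trans (by norm_num)
  have h5 : (m * b ^ 2).natDegree ≤ 14 :=
    (natDegree_mul_le_of_le h10 (natDegree_pow_le_of_le 2 h31)).trans (by norm_num)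
  exact natDegree_sub_le_of_le (natDegree_sub_le_of_le (natDegree_sub_le_of_le
    (natDegree_add_le_of_degree_le h1 h2) h3) h4) h5

lemma natDegree_resolvent_le (t : Fin 5 → S) : (resolvent t).natDegree ≤ 14 := by
  refine natDegree_bezoutDet_le ?_ ?_ ?_ ?_ ?_ ?_
  · simp only [eqFst, eqSnd, coefFst, coefSnd, Matrix.cons_val]
    compute_degree
  · simp only [eqFst, eqSnd, coefFst, coefSnd, Matrix.cons_val]
    compute_degree
  · simp only [eqFst, eqSnd, coefFst, coefSnd, Matrix.cons_val]
    compute_degree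
  · simp only [eqFst, eqSnd, coefFst, coefSnd, Matrix.cons_val]
    compute_degree
  · simp only [eqFst, eqSnd, coefFst, coefSnd, Matrix.cons_val]
    compute_degree
  · have h : ∀ (t : Fin 5 → S[X]) (y : S[X]),
        eqSnd t y 1 * eqFst t y 0 - eqSnd t y 0 * eqFst t y 1
          = ((12 * (t 0 * t 1) * (t 0 - t 1) - 6 * (t 0 - t 1) ^ 3
            + (12 * (t 0 - t 1) ^ 2 - 6 * (t 0 * t 1)) * y - 6 * (t 0 - t 1) * y ^ 2) * t 2
            + 6 * (t 0 * t 1) ^ 2 * (t 0 - t 1) * (t 0 + t 1)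
            + (6 * (t 0 - t 1) ^ 2 - 4 * (t 0 * t 1) - 6 * (t 0 - t 1) * y + 2 * y ^ 2) * t 3
            - (t 0 + t 1) * (2 * (t 0 * t 1) ^ 2 * y - 2 * (t 0 * t 1) * (t 0 - t 1) * y ^ 2)
            + (y - 2 * (t 0 - t 1)) * t 4)
            * (y ^ 2 * (t 4 - 2 * (t 0 - t 1) * t 3) - 6 * (t 0 * t 1) * (t 0 - t 1) * t 2 * y
              - 6 * (t 0 * t 1) ^ 2 * t 2)
          - (t 0 * t 1 * y * (t 4 - 2 * (t 0 - t 1) * t 3) + 2 * (t 0 * t 1) ^ 2 * t 3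
              - 6 * (t 0 * t 1) ^ 2 * (t 0 - t 1) * t 2)
            * (4 * (t 4 - 2 * (t 0 - t 1) * t 3) + (t 0 + t 1) * (2 * (t 0 - t 1) * y ^ 3)
              + t 2 * (6 * (t 0 - t 1) ^ 2 - 12 * (t 0 * t 1) - 6 * (t 0 - t 1) * y)
              + (t 0 + t 1) * (6 * (t 0 * t 1) ^ 2 + 6 * (t 0 * t 1) * (t 0 - t 1) * y))
          + (t 0 + t 1) * y ^ 3 * (2 * (t 0 * t 1) ^ 2 * t 3 * y + 6 * (t 0 * t 1) ^ 3 * t 2) := by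
      intro t y
      simp only [eqFst, eqSnd, coefFst, coefSnd, Matrix.cons_val]
      ring
    rw [h]
    compute_degree

end Degree

end Resolvent

section TestPoint

open Polynomial

local notation "Y" => (Polynomial.X : Polynomial ℂ)

lemma isCoprime_of_mul_add_mul_eq_C {K : Type*} [Field K] {p q u v : K[X]} {n : K} (hn : n ≠ 0)
    (h : u * p + v * q = Polynomial.C n) : IsCoprime p q := by
  refine ⟨Polynomial.C n⁻¹ * u, Polynomial.C n⁻¹ * v, ?_⟩
  rw [mul_assoc, mul_assoc, ← mul_add, h, ← Polynomial.C_mul, inv_mul_cancel₀ hn, Polynomial.C_1]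

lemma resolvent_testPoint : resolvent ![(1 : ℂ), 1, 1, 1, 0] = 64
      * (-36 * Y ^ 14 - 108 * Y ^ 13 + 264 * Y ^ 12 - 126 * Y ^ 11 - 811 * Y ^ 10 + 3864 * Y ^ 9
      + 1340 * Y ^ 8 - 7138 * Y ^ 7 + 236 * Y ^ 6 + 1952 * Y ^ 5 - 1168 * Y ^ 4 + 2096 * Y ^ 3
      - 160 * Y ^ 2 - 576 * Y + 128) := by
  simp only [resolvent, bezoutDet, eqFst, eqSnd, coefFst, coefSnd, Matrix.cons_val, map_one,
    map_zero]
  ring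

lemma natDegree_resolvent_testPoint : (resolvent ![(1 : ℂ), 1, 1, 1, 0]).natDegree = 14 := by
  rw [resolvent_testPoint]
  compute_degree!

lemma derivative_resolvent_testPoint :
    (resolvent ![(1 : ℂ), 1, 1, 1, 0]).derivative = 64
      * (-504 * Y ^ 13 - 1404 * Y ^ 12 + 3168 * Y ^ 11 - 1386 * Y ^ 10 - 8110 * Y ^ 9 + 34776 * Y ^ 8
      + 10720 * Y ^ 7 - 49966 * Y ^ 6 + 1416 * Y ^ 5 + 9760 * Y ^ 4 - 4672 * Y ^ 3 + 6288 * Y ^ 2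
      - 320 * Y - 576) := by
  rw [resolvent_testPoint]
  simp only [derivative_mul, derivative_add, derivative_sub, derivative_neg, derivative_ofNat,
    derivative_X, derivative_X_pow, map_natCast]
  push_cast
  ring

lemma isCoprime_resolvent_testPoint :
    IsCoprime (resolvent ![(1 : ℂ), 1, 1, 1, 0])
      (resolvent ![(1 : ℂ), 1, 1, 1, 0]).derivative := by
  refine isCoprime_of_mul_add_mul_eq_C (u := 311722706982607316101631077212390671657403864 * Y ^ 12
      + 983786403562000269263194744255010057073957852 * Y ^ 11
      - 1586008242172043446902221607400836108671437512 * Y ^ 10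
      + 299422647347973348693319601803676152130568834 * Y ^ 9
      + 5085927338029400278822629125381275173676452218 * Y ^ 8
      - 19608087838452283365658538877147750686804507668 * Y ^ 7
      - 13758379686689322271113805129639634299984590216 * Y ^ 6
      + 25256377960716169002592857747889360516963007510 * Y ^ 5
      + 8086731784499917611961043133032492474568994484 * Y ^ 4
      - 2559033701388948808697333556238801319653635192 * Y ^ 3
      + 2102259720222200473861197495380091880519490960 * Y ^ 2
      - 3002685449802327736381038697121581199055310768 * Y
      - 833942920640194877642618251896520468024872096)
    (v := -22265907641614808292973648372313619404100276 * Y ^ 13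
      - 75041723320488906724436834955139351091875620 * Y ^ 12
      + 134845920456818608785425293858107646282822656 * Y ^ 11
      - 30244205354743765822486516630393917554673078 * Y ^ 10
      - 509250651600813986391231883767617237352877811 * Y ^ 9
      + 2199778555749195071011141378433715754882082266 * Y ^ 8
      + 1629813276054689890506579472922647542359914976 * Y ^ 7
      - 3748852817811947566996836919558373122228799466 * Y ^ 6
      - 1195485326711933796921342340374512227727996168 * Y ^ 5
      + 684039705283237851778316750660970429262626032 * Y ^ 4
      - 495997660573146923469271279880377596221611440 * Y ^ 3
      + 1100754465616298210727348564430286815973102224 * Y ^ 2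
      + 290811234191400263646050969841873181337178752 * Y
      - 223437144313100789358594371150267363584276288)
    (n := 64 * 21955101282401110332295221539799381517359513600) (by norm_num) ?_
  rw [derivative_resolvent_testPoint, resolvent_testPoint]
  simp only [map_mul, map_ofNat]
  ring

end TestPoint


section Genericity

/-- A property holds generically on `ℂ⁵` if it holds off the zero locus of a nonzero polynomial. -/
def Generic (P : (Fin 5 → ℂ) → Prop) : Prop :=
  ∃ g : MvPolynomial (Fin 5) ℂ, g ≠ 0 ∧ ∀ u, eval u g ≠ 0 → P u

lemma Generic.and {P Q : (Fin 5 → ℂ) → Prop} (hP : Generic P) (hQ : Generic Q) :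
    Generic fun u => P u ∧ Q u := by
  obtain ⟨g, hg, hgP⟩ := hP
  obtain ⟨h, hh, hhQ⟩ := hQ
  refine ⟨g * h, mul_ne_zero hg hh, fun u hu => ?_⟩
  rw [map_mul] at hu
  exact ⟨hgP u (left_ne_zero_of_mul hu), hhQ u (right_ne_zero_of_mul hu)⟩

lemma Generic.mono {P Q : (Fin 5 → ℂ) → Prop} (hP : Generic P) (h : ∀ u, P u → Q u) :
    Generic Q := by
  obtain ⟨g, hg, hgP⟩ := hP
  exact ⟨g, hg, fun u hu => h u (hgP u hu)⟩

lemma generic_eval_ne_zero (g : MvPolynomial (Fin 5) ℂ) (t : Fin 5 → ℂ) (h : eval t g ≠ 0) :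
    Generic fun u => eval u g ≠ 0 :=
  ⟨g, fun hg => h (by rw [hg, map_zero]), fun _ hu => hu⟩

/-- Generic properties pull back along polynomial maps that are generically surjective. -/
lemma Generic.comap {P : (Fin 5 → ℂ) → Prop} (hP : Generic P)
    (φ : Fin 5 → MvPolynomial (Fin 5) ℂ) {Q : (Fin 5 → ℂ) → Prop} (hQ : Generic Q)
    (hφ : ∀ t, Q t → ∃ u, ∀ i, eval u (φ i) = t i) :
    Generic fun u => P fun i => eval u (φ i) := by
  obtain ⟨g, hg, hgP⟩ := hP
  obtain ⟨h, hh, hhQ⟩ := hQ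
  have heval : ∀ u, eval u (bind₁ φ g) = eval (fun i => eval u (φ i)) g := fun u => by
    simp only [eval, eval₂Hom_bind₁]
  refine ⟨bind₁ φ g, fun h0 => mul_ne_zero hg hh (MvPolynomial.funext fun t => ?_), fun u hu => ?_⟩
  · by_contra hne
    rw [map_mul, map_zero] at hne
    obtain ⟨u, hu⟩ := hφ t (hhQ t (right_ne_zero_of_mul hne))
    refine left_ne_zero_of_mul hne ?_
    rw [← _root_.funext hu, ← heval, h0, map_zero]
  · exact hgP _ (by rwa [← heval])

lemma map_resolvent_X (t : Fin 5 → ℂ) :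
    (resolvent (X : Fin 5 → MvPolynomial (Fin 5) ℂ)).map (eval t) = resolvent t := by
  simp [map_resolvent]

lemma generic_natDegree_resolvent : Generic fun t => (resolvent t).natDegree = 14 := by
  refine (generic_eval_ne_zero ((resolvent X).coeff 14) ![1, 1, 1, 1, 0] ?_).mono fun t ht => ?_
  · rw [← Polynomial.coeff_map, map_resolvent_X, ← natDegree_resolvent_testPoint,
      Polynomial.coeff_natDegree, Polynomial.leadingCoeff_ne_zero]
    intro h
    simpa [h] using natDegree_resolvent_testPoint
  · rw [← Polynomial.coeff_map, map_resolvent_X] at ht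
    exact le_antisymm (natDegree_resolvent_le t) (Polynomial.le_natDegree_of_ne_zero ht)

lemma generic_separable_resolvent : Generic fun t => (resolvent t).Separable := by
  have hres : ∀ t : Fin 5 → ℂ, eval t (Polynomial.resultant
      (resolvent (X : Fin 5 → MvPolynomial (Fin 5) ℂ)) (resolvent X).derivative 14 13)
      = Polynomial.resultant (resolvent t) (resolvent t).derivative 14 13 := fun t => by
    rw [← Polynomial.resultant_map_map, ← Polynomial.derivative_map, map_resolvent_X]
  have hder : ∀ t : Fin 5 → ℂ, (resolvent t).derivative.natDegree ≤ 13 := fun t =>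
    (Polynomial.natDegree_derivative_le _).trans (Nat.sub_le_sub_right (natDegree_resolvent_le t) 1)
  refine (generic_eval_ne_zero (Polynomial.resultant (resolvent X) (resolvent X).derivative 14 13)
    ![1, 1, 1, 1, 0] ?_).mono fun t ht => ?_
  · rw [hres]
    have h := Polynomial.resultant_ne_zero _ _ isCoprime_resolvent_testPoint
    have h13 : (resolvent ![(1 : ℂ), 1, 1, 1, 0]).derivative.natDegree = 13 := by
      rw [Polynomial.natDegree_derivative, natDegree_resolvent_testPoint]
    rwa [natDegree_resolvent_testPoint, h13] at h
  · rw [hres] at ht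
    obtain ⟨p, q, -, -, hpq⟩ := Polynomial.exists_mul_add_mul_eq_C_resultant (resolvent t)
      (resolvent t).derivative (natDegree_resolvent_le t) (hder t) (Or.inl (by norm_num))
    refine isCoprime_of_mul_add_mul_eq_C (u := p) (v := q) ht ?_
    rw [mul_comm p, mul_comm q]
    exact hpq

end Genericity

section Moments

variable {S : Type*} [CommRing S]

/-- The vector whose `k`-th entry is obtained from `(c + η) ^ k * (b - η) ^ (4 - k)` by replacing
`η ^ j` with `w j`. -/
def fromMoments (b c : S) (w : Fin 5 → S) : Fin 5 → S :=
  ![b ^ 4 * w 0 - 4 * b ^ 3 * w 1 + 6 * b ^ 2 * w 2 - 4 * b * w 3 + w 4,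
    b ^ 3 * c * w 0 + (b ^ 3 - 3 * b ^ 2 * c) * w 1 + (3 * b * c - 3 * b ^ 2) * w 2
      + (3 * b - c) * w 3 - w 4,
    b ^ 2 * c ^ 2 * w 0 + (2 * b ^ 2 * c - 2 * b * c ^ 2) * w 1
      + (b ^ 2 - 4 * b * c + c ^ 2) * w 2 + (2 * c - 2 * b) * w 3 + w 4,
    b * c ^ 3 * w 0 - (c ^ 3 - 3 * b * c ^ 2) * w 1 + (3 * b * c - 3 * c ^ 2) * w 2
      - (3 * c - b) * w 3 - w 4,
    c ^ 4 * w 0 + 4 * c ^ 3 * w 1 + 6 * c ^ 2 * w 2 + 4 * c * w 3 + w 4]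

/-- The central moments of a vector: the `j`-th one pairs it with the coefficients of
`(b x - c y) ^ j * (x + y) ^ (4 - j)`. -/
def toMoments (b c : S) (a : Fin 5 → S) : Fin 5 → S :=
  ![a 0 + 4 * a 1 + 6 * a 2 + 4 * a 3 + a 4,
    -c * a 0 + (b - 3 * c) * a 1 + (3 * b - 3 * c) * a 2 + (3 * b - c) * a 3 + b * a 4,
    c ^ 2 * a 0 + (2 * c ^ 2 - 2 * b * c) * a 1 + (c ^ 2 - 4 * b * c + b ^ 2) * a 2
      + (2 * b ^ 2 - 2 * b * c) * a 3 + b ^ 2 * a 4,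
    -c ^ 3 * a 0 + (3 * b * c ^ 2 - c ^ 3) * a 1 + (3 * b * c ^ 2 - 3 * b ^ 2 * c) * a 2
      + (b ^ 3 - 3 * b ^ 2 * c) * a 3 + b ^ 3 * a 4,
    c ^ 4 * a 0 - 4 * b * c ^ 3 * a 1 + 6 * b ^ 2 * c ^ 2 * a 2 - 4 * b ^ 3 * c * a 3
      + b ^ 4 * a 4]

lemma fromMoments_toMoments (b c : S) (a : Fin 5 → S) (k : Fin 5) :
    fromMoments b c (toMoments b c a) k = (b + c) ^ 4 * a k := by
  fin_cases k <;> simp [fromMoments, toMoments] <;> ring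

lemma toMoments_fromMoments (b c : S) (w : Fin 5 → S) (j : Fin 5) :
    toMoments b c (fromMoments b c w) j = (b + c) ^ 4 * w j := by
  fin_cases j <;> simp [fromMoments, toMoments] <;> ring

/-- The binomial coefficients of exponent four. -/
def binom : Fin 5 → S := ![1, 4, 6, 4, 1]

/-- The vectors with total mass one and centred first moment at which the Hankel determinant
vanishes, in terms of the second central moment `x` and the ratio `y` of the third by the second. -/
def central (b c x y : S) : Fin 5 → S :=
  fromMoments b c ![1, 0, x, x * y, x * y ^ 2 + x ^ 2]

/-- The kernel vector of the Hankel matrix of `central b c x y`. -/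
def kernelVec (b c x y : S) : Fin 3 → S :=
  ![c ^ 2 + c * y - x, -2 * b * c - y * (b - c) - 2 * x, b ^ 2 - b * y - x]

/-- The gradient of the Hankel determinant at a matrix of rank two with kernel vector `n`, up to a
factor. -/
def kernelGrad (n : Fin 3 → S) : Fin 5 → S :=
  ![6 * n 0 ^ 2, 3 * n 0 * n 1, n 1 ^ 2 + 2 * n 0 * n 2, 3 * n 1 * n 2, 6 * n 2 ^ 2]

/-- The gradient of the Hankel determinant, up to a factor. -/
def hankelGrad (a : Fin 5 → S) : Fin 5 → S :=
  ![6 * (a 2 * a 4 - a 3 ^ 2), 3 * (a 2 * a 3 - a 1 * a 4),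
    a 0 * a 4 + 2 * a 1 * a 3 - 3 * a 2 ^ 2, 3 * (a 1 * a 2 - a 0 * a 3),
    6 * (a 0 * a 2 - a 1 ^ 2)]

lemma hankelGrad_central (b c x y : S) (k : Fin 5) :
    hankelGrad (central b c x y) k
      = (b + c) ^ 2 * x * kernelGrad (kernelVec b c x y) k := by
  fin_cases k <;> simp [hankelGrad, central, fromMoments, kernelGrad, kernelVec] <;> ring

lemma central_kernelVec (b c x y : S) :
    central b c x y 0 * kernelVec b c x y 0 + central b c x y 1 * kernelVec b c x y 1
        + central b c x y 2 * kernelVec b c x y 2 = 0 ∧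
      central b c x y 1 * kernelVec b c x y 0 + central b c x y 2 * kernelVec b c x y 1
        + central b c x y 3 * kernelVec b c x y 2 = 0 ∧
      central b c x y 2 * kernelVec b c x y 0 + central b c x y 3 * kernelVec b c x y 1
        + central b c x y 4 * kernelVec b c x y 2 = 0 := by
  simp only [central, fromMoments, kernelVec, Matrix.cons_val]
  refine ⟨?_, ?_, ?_⟩ <;> ring

/-- The first linear form annihilating the moments of the gradient direction. -/
def rowFst (p e x y : S) : Fin 3 → S :=
  ![-6 * p ^ 2 - 6 * p * e * y + (6 * e ^ 2 - 12 * p) * x - 6 * e * x * y - 6 * x ^ 2,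
    -2 * e * (y ^ 2 + 4 * x), y ^ 2 + 4 * x]

/-- The second linear form annihilating the moments of the gradient direction. -/
def rowSnd (p e x y : S) : Fin 3 → S :=
  ![-6 * p ^ 2 * e + (12 * p * e - 6 * e ^ 3) * x + (12 * e ^ 2 - 6 * p) * x * y
      - 6 * e * x * y ^ 2 + 6 * e * x ^ 2 - 6 * x ^ 2 * y,
    2 * p ^ 2 - 2 * p * e * y + (6 * e ^ 2 - 4 * p) * x - 6 * e * x * y + 2 * x * y ^ 2
      + 2 * x ^ 2,
    p * y - 2 * e * x + x * y]

/-- The moments of the gradient direction, as the cross product of two linear forms. -/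
def direction (b c x y : S) : Fin 3 → S :=
  crossProduct (rowSnd (b * c) (b - c) x y) (rowFst (b * c) (b - c) x y)

lemma fromMoments_direction (b c x y : S) (k : Fin 5) :
    fromMoments b c ![0, 0, direction b c x y 0, direction b c x y 1, direction b c x y 2] k
      = 2 * (central b c x y k * kernelGrad (kernelVec b c x y) k) := by
  fin_cases k <;> simp [direction, crossProduct, rowFst, rowSnd, fromMoments, central, kernelVec,
    kernelGrad] <;> ring

/-- The difference between the moments of the data and those of a candidate critical point. -/
def residual (t : Fin 5 → S) (x y : S) : Fin 3 → S :=
  ![t 2 - (t 0 + t 1) * x, t 3 - (t 0 + t 1) * (x * y),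
    t 4 - (t 0 + t 1) * (x * y ^ 2 + x ^ 2)]

lemma cubic_eqFst (t : Fin 5 → S) (x y : S) :
    cubic (eqFst t y) x = rowFst (t 0 * t 1) (t 0 - t 1) x y ⬝ᵥ residual t x y := by
  simp [cubic, eqFst, coefFst, rowFst, residual, dotProduct, Fin.sum_univ_three]
  ring

lemma cubic_eqSnd (t : Fin 5 → S) (x y : S) :
    cubic (eqSnd t y) x = rowSnd (t 0 * t 1) (t 0 - t 1) x y ⬝ᵥ residual t x y := by
  simp [cubic, eqSnd, coefSnd, rowSnd, residual, dotProduct, Fin.sum_univ_three]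
  ring

/-- The data vector with parameters `t`, up to a power of the total mass. -/
def dataVec (t : Fin 5 → S) : Fin 5 → S :=
  fromMoments (t 0) (t 1) ![t 0 + t 1, 0, t 2, t 3, t 4]

lemma dataVec_sub_central (t : Fin 5 → S) (x y : S) (k : Fin 5) :
    dataVec t k - (t 0 + t 1) * central (t 0) (t 1) x y k
      = fromMoments (t 0) (t 1) ![0, 0, residual t x y 0, residual t x y 1, residual t x y 2] k := by
  fin_cases k <;> simp [dataVec, central, fromMoments, residual] <;> ring

end Moments

section GoodParameters

/-- The obstruction to the point `4 x = -(b - c) ^ 2`, `2 (b - c) y = (b - c) ^ 2 - 4 b c`, at which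
the gradient direction vanishes, being a solution. -/
def alternatingObstruction {S : Type*} [CommRing S] (s p e α β γ : S) : S :=
  ((e ^ 2 - 4 * p) ^ 2 - 4 * e ^ 4) * (16 * (γ - 2 * e * β)
      + s * ((e ^ 2 - 4 * p) ^ 2 - e ^ 4 - 4 * e ^ 2 * (e ^ 2 - 4 * p)))
    + e ^ 2 * (-96 * p ^ 2 - 48 * p * (e ^ 2 - 4 * p) - 30 * e ^ 4 + 48 * p * e ^ 2
      + 12 * e ^ 2 * (e ^ 2 - 4 * p)) * (4 * α + s * e ^ 2)

/-- The genericity conditions on the parameters `t = (b, c, α, β, γ)` of the data vector. -/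
structure Good (t : Fin 5 → ℂ) : Prop where
  sum_ne : t 0 + t 1 ≠ 0
  fst_ne : t 0 ≠ 0
  snd_ne : t 1 ≠ 0
  diff_ne : t 0 - t 1 ≠ 0
  dataVec_ne : ∀ k, dataVec t k ≠ 0
  degenerate_ne : 2 * t 3 ^ 2 - 3 * t 2 * t 4 ≠ 0
  centred_ne : 3 * (t 0 - t 1) * t 2 * (t 4 - 2 * (t 0 - t 1) * t 3)
    - t 3 * ((t 0 + t 1) * (t 0 * t 1) ^ 2 + (t 4 - 2 * (t 0 - t 1) * t 3)) ≠ 0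
  product_ne : cubic (eqFst t (t 0 - t 1)) (t 0 * t 1) ≠ 0
  alternating_ne :
    alternatingObstruction (t 0 + t 1) (t 0 * t 1) (t 0 - t 1) (t 2) (t 3) (t 4) ≠ 0
  natDegree_eq : (resolvent t).natDegree = 14
  separable : (resolvent t).Separable

lemma central_mass (b c x y : ℂ) :
    central b c x y 0 + 4 * central b c x y 1 + 6 * central b c x y 2 + 4 * central b c x y 3
      + central b c x y 4 = (b + c) ^ 4 := by
  simp [central, fromMoments]; ring

lemma central_first_moment (b c x y : ℂ) :
    central b c x y 1 + 3 * central b c x y 2 + 3 * central b c x y 3 + central b c x y 4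
      = c * (b + c) ^ 3 := by
  simp [central, fromMoments]; ring

lemma central_second_moment (b c x y : ℂ) :
    c ^ 2 * central b c x y 0 + (2 * c ^ 2 - 2 * b * c) * central b c x y 1
      + (c ^ 2 - 4 * b * c + b ^ 2) * central b c x y 2
      + (2 * b ^ 2 - 2 * b * c) * central b c x y 3 + b ^ 2 * central b c x y 4
      = (b + c) ^ 4 * x := by
  simp [central, fromMoments]; ring

lemma Good.cubic_alternating_ne {t : Fin 5 → ℂ} (ht : Good t) {x y : ℂ}
    (hx : 4 * x = -(t 0 - t 1) ^ 2)
    (hy : 2 * (t 0 - t 1) * y = (t 0 - t 1) ^ 2 - 4 * (t 0 * t 1)) :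
    cubic (eqFst t y) x ≠ 0 := by
  intro h
  apply ht.alternating_ne
  have key : ∀ s p e α β γ x y : ℂ, e ≠ 0 → 4 * x = -e ^ 2 → 2 * e * y = e ^ 2 - 4 * p →
      alternatingObstruction s p e α β γ = 64 * e ^ 2 * cubic (coefFst s p e α β γ y) x := by
    intro s p e α β γ x y he hx hy
    obtain rfl : x = -e ^ 2 / 4 := by linear_combination hx / 4
    obtain rfl : y = (e ^ 2 - 4 * p) / (2 * e) := by field_simp; linear_combination hy
    simp only [alternatingObstruction, cubic, coefFst, Matrix.cons_val]
    field_simp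
    ring
  rw [key _ _ _ _ _ _ x y ht.diff_ne hx hy]
  unfold eqFst at h
  rw [h, mul_zero]

lemma Good.direction_ne_zero {t : Fin 5 → ℂ} (ht : Good t) {x y : ℂ} (hc : y ≠ -2 * t 1)
    (hb : y ≠ 2 * t 0) (hcub : cubic (eqFst t y) x = 0) : direction (t 0) (t 1) x y ≠ 0 := by
  intro hdir
  have hprod : ∀ k, central (t 0) (t 1) x y k * kernelGrad (kernelVec (t 0) (t 1) x y) k = 0 := by
    intro k
    have h := fromMoments_direction (t 0) (t 1) x y k
    rw [hdir] at h
    have h0 : fromMoments (t 0) (t 1) ![0, 0, (0 : Fin 3 → ℂ) 0, (0 : Fin 3 → ℂ) 1,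
        (0 : Fin 3 → ℂ) 2] k = 0 := by
      fin_cases k <;> simp [fromMoments]
    rw [h0] at h
    linear_combination -h / 2
  obtain ⟨k1, k2, k3⟩ := central_kernelVec (t 0) (t 1) x y
  have hmass := central_mass (t 0) (t 1) x y
  have hfst := central_first_moment (t 0) (t 1) x y
  have hsnd := central_second_moment (t 0) (t 1) x y
  have hs := ht.sum_ne
  have h01 : kernelVec (t 0) (t 1) x y 1 - 2 * kernelVec (t 0) (t 1) x y 0
      = -(t 0 + t 1) * (y + 2 * t 1) := by simp [kernelVec]; ring
  have h21 : kernelVec (t 0) (t 1) x y 1 - 2 * kernelVec (t 0) (t 1) x y 2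
      = (t 0 + t 1) * (y - 2 * t 0) := by simp [kernelVec]; ring
  have hn0 : kernelVec (t 0) (t 1) x y 0 = t 1 ^ 2 + t 1 * y - x := by simp [kernelVec]
  have hn1 : kernelVec (t 0) (t 1) x y 1 = -2 * t 0 * t 1 - y * (t 0 - t 1) - 2 * x := by
    simp [kernelVec]
  have hn2 : kernelVec (t 0) (t 1) x y 2 = t 0 ^ 2 - t 0 * y - x := by simp [kernelVec]
  have p0 := hprod 0
  have p1 := hprod 1
  have p2 := hprod 2
  have p3 := hprod 3
  have p4 := hprod 4
  simp only [kernelGrad, Matrix.cons_val] at p0 p1 p2 p3 p4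
  generalize kernelVec (t 0) (t 1) x y 0 = n0 at *
  generalize kernelVec (t 0) (t 1) x y 1 = n1 at *
  generalize kernelVec (t 0) (t 1) x y 2 = n2 at *
  generalize central (t 0) (t 1) x y 0 = a0 at *
  generalize central (t 0) (t 1) x y 1 = a1 at *
  generalize central (t 0) (t 1) x y 2 = a2 at *
  generalize central (t 0) (t 1) x y 3 = a3 at *
  generalize central (t 0) (t 1) x y 4 = a4 at *
  have hc' : y + 2 * t 1 ≠ 0 := fun h => hc (by linear_combination h)
  have hb' : y - 2 * t 0 ≠ 0 := fun h => hb (by linear_combination h)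
  by_cases z0 : n0 = 0
  · have z1 : n1 ≠ 0 := by
      intro z1
      rw [z0, z1] at h01
      exact mul_ne_zero (neg_ne_zero.2 hs) hc' (by linear_combination -h01)
    have a2z : a2 = 0 := by simpa [z0, z1] using p2
    have a1z : a1 = 0 := by simpa [z0, z1, a2z] using k1
    by_cases z2 : n2 = 0
    · have hy : y = t 0 - t 1 := by
        refine sub_eq_zero.1 ((mul_eq_zero.1 ?_).resolve_left hs)
        linear_combination z0 - z2 - hn0 + hn2
      subst hy
      obtain rfl : x = t 0 * t 1 := by linear_combination hn0 - z0
      exact ht.product_ne hcub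
    · have a3z : a3 = 0 := by simpa [z0, z2, a2z] using k2
      have a4z : a4 = 0 := by simpa [z0, z2, a2z, a3z] using k3
      rw [a1z, a2z, a3z, a4z] at hfst
      exact mul_ne_zero ht.snd_ne (pow_ne_zero 3 hs) (by linear_combination -hfst)
  · have a0z : a0 = 0 := by simpa [z0] using p0
    by_cases z2 : n2 = 0
    · have z1 : n1 ≠ 0 := by
        intro z1
        rw [z2, z1] at h21
        exact mul_ne_zero hs hb' (by linear_combination -h21)
      have a2z : a2 = 0 := by simpa [z2, z1] using p2
      have a1z : a1 = 0 := by simpa [z0, z2, a2z] using k2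
      have a3z : a3 = 0 := by simpa [z1, z2, a2z] using k3
      rw [a0z, a1z, a2z, a3z] at hmass
      rw [a1z, a2z, a3z] at hfst
      exact mul_ne_zero ht.fst_ne (pow_ne_zero 3 hs) (by linear_combination hfst - hmass)
    · have a4z : a4 = 0 := by simpa [z2] using p4
      by_cases z1 : n1 = 0
      · have a2z : a2 = 0 := by simpa [z0, z1, z2] using p2
        rw [a0z, a2z, a4z] at hmass hsnd
        rw [a2z, a4z] at hfst
        have hx : 4 * x = -(t 0 - t 1) ^ 2 := by
          refine mul_left_cancel₀ (pow_ne_zero 4 hs) ?_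
          linear_combination -4 * hsnd + (hfst - hmass / 4) * 4 * (t 0 - t 1) * (t 0 + t 1)
            + 2 * (-t 1) * (t 0 - t 1) * hmass
        exact ht.cubic_alternating_ne hx (by linear_combination 2 * hn1 - 2 * z1 - hx) hcub
      · have a1z : a1 = 0 := by simpa [z0, z1] using p1
        have a3z : a3 = 0 := by simpa [z1, z2] using p3
        have a2z : a2 = 0 := by simpa [a0z, a1z, z2] using k1
        rw [a0z, a1z, a2z, a3z, a4z] at hmass
        exact pow_ne_zero 4 hs (by linear_combination -hmass)

lemma Good.second_moment_ne_zero {t : Fin 5 → ℂ} (ht : Good t) {x y : ℂ}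
    (h1 : cubic (eqFst t y) x = 0) (h2 : cubic (eqSnd t y) x = 0) : x ≠ 0 := by
  rintro rfl
  simp only [cubic, eqFst, eqSnd, coefFst, coefSnd, Matrix.cons_val] at h1 h2
  have hp := mul_ne_zero ht.fst_ne ht.snd_ne
  have h3 : y * (t 4 - 2 * (t 0 - t 1) * t 3)
      = (t 0 * t 1) * (6 * (t 0 - t 1) * t 2 - 2 * t 3) := by
    refine mul_left_cancel₀ hp ?_
    linear_combination h2
  refine mul_ne_zero (pow_ne_zero 2 hp) ht.degenerate_ne ?_
  linear_combination (t 4 - 2 * (t 0 - t 1) * t 3) / 2 * h1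
    - (y * (t 4 - 2 * (t 0 - t 1) * t 3) + t 0 * t 1 * (6 * (t 0 - t 1) * t 2 - 2 * t 3)
      - 6 * (t 0 * t 1) * (t 0 - t 1) * t 2) / 2 * h3

lemma exists_eq_smul_crossProduct {K : Type*} [Field K] {r q v : Fin 3 → K}
    (hr : r ⬝ᵥ v = 0) (hq : q ⬝ᵥ v = 0) (h : crossProduct q r ≠ 0) :
    ∃ m : K, v = m • crossProduct q r := by
  have hv : crossProduct v (crossProduct q r) = 0 := by
    simp only [dotProduct, Fin.sum_univ_three] at hr hq
    ext i
    fin_cases i <;> simp [crossProduct]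
    · linear_combination q 0 * hr - r 0 * hq
    · linear_combination q 1 * hr - r 1 * hq
    · linear_combination q 2 * hr - r 2 * hq
  generalize crossProduct q r = n at *
  obtain ⟨i, hi⟩ := Function.ne_iff.1 h
  refine ⟨v i / n i, ?_⟩
  have c0 := congrFun hv 0
  have c1 := congrFun hv 1
  have c2 := congrFun hv 2
  simp [crossProduct] at c0 c1 c2
  simp only [Pi.zero_apply] at hi
  ext j
  simp only [Pi.smul_apply, smul_eq_mul]
  field_simp
  fin_cases i <;> fin_cases j <;> simp <;> grind

end GoodParameters

section CriticalPoints

/-- The critical points of the pair formed by the Hankel determinant and the sum of the coordinates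
minus one. -/
def critSet (u : Fin 5 → ℂ) : Set (Fin 5 → ℂ) :=
  {z : Fin 5 → ℂ | (∀ i, z i ≠ 0) ∧ eval z hankelDet = 0 ∧
    z 0 + z 1 + z 2 + z 3 + z 4 - 1 = 0 ∧
    ∃ lam mu : ℂ, ∀ i, u i = lam * z i * eval z (pderiv i hankelDet) + mu * z i}

lemma hankelDet_eq : hankelDet = 288 * X 0 * X 2 * X 4 - 108 * X 0 * X 3 ^ 2
    - 108 * X 1 ^ 2 * X 4 + 36 * X 1 * X 2 * X 3 - 8 * X 2 ^ 3 := by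
  simp only [hankelDet, Matrix.det_fin_three, Matrix.of_apply, Matrix.cons_val]
  ring

lemma eval_hankelDet (a : Fin 5 → ℂ) : eval (fun k => binom k * a k) hankelDet
    = 1728 * (a 0 * a 2 * a 4 - a 0 * a 3 ^ 2 - a 1 ^ 2 * a 4 + 2 * a 1 * a 2 * a 3
      - a 2 ^ 3) := by
  simp [hankelDet_eq, binom]
  ring

lemma eval_pderiv_hankelDet (a : Fin 5 → ℂ) (k : Fin 5) :
    eval (fun k => binom k * a k) (pderiv k hankelDet) = 288 * hankelGrad a k := by
  have h : ∀ (k : Fin 5) (n : ℕ) [n.AtLeastTwo],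
      pderiv k (OfNat.ofNat n : MvPolynomial (Fin 5) ℂ) = 0 := by
    intro k n _
    rw [← map_ofNat (C : ℂ →+* MvPolynomial (Fin 5) ℂ) n, pderiv_C]
  rw [hankelDet_eq]
  fin_cases k <;> simp [Derivation.leibniz_pow, pderiv_X, h, binom, hankelGrad] <;>
    ring

lemma binom_ne_zero (k : Fin 5) : (binom k : ℂ) ≠ 0 := by
  fin_cases k <;> simp [binom]

lemma eq_mul_of_fromMoments_eq {b c m : ℂ} (hs : b + c ≠ 0) {w w' : Fin 5 → ℂ}
    (h : ∀ k, fromMoments b c w k = m * fromMoments b c w' k) (j : Fin 5) : w j = m * w' j := by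
  refine mul_left_cancel₀ (pow_ne_zero 4 hs) ?_
  rw [← toMoments_fromMoments, _root_.funext h, mul_left_comm, ← toMoments_fromMoments]
  fin_cases j <;> simp [toMoments] <;> ring

lemma hankelGrad_smul (m : ℂ) (a : Fin 5 → ℂ) (k : Fin 5) :
    hankelGrad (fun i => m * a i) k = m ^ 2 * hankelGrad a k := by
  fin_cases k <;> simp [hankelGrad] <;> ring

/-- The linear relations satisfied by the critical points. -/
lemma exists_moments_of_mem_critSet {t u z : Fin 5 → ℂ} (hs : t 0 + t 1 ≠ 0)
    (hu : ∀ k, (t 0 + t 1) ^ 4 * u k = binom k * dataVec t k) (hz : z ∈ critSet u) :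
    ∃ P Q R m : ℂ,
      (∀ k, (t 0 + t 1) ^ 4 * z k = binom k * fromMoments (t 0) (t 1) ![1, 0, P, Q, R] k) ∧
      P * R = Q ^ 2 + P ^ 3 ∧
      ∀ k, dataVec t k - (t 0 + t 1) * fromMoments (t 0) (t 1) ![1, 0, P, Q, R] k
        = m * (fromMoments (t 0) (t 1) ![1, 0, P, Q, R] k
          * hankelGrad (fromMoments (t 0) (t 1) ![1, 0, P, Q, R]) k) := by
  obtain ⟨-, hdet, hsum, lam, mu, hcrit⟩ := hz
  obtain ⟨a, rfl⟩ : ∃ a : Fin 5 → ℂ, z = fun k => binom k * a k :=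
    ⟨fun k => z k / binom k, _root_.funext fun k => by
      rw [mul_div_cancel₀ _ (binom_ne_zero k)]⟩
  rw [eval_hankelDet] at hdet
  simp only [eval_pderiv_hankelDet] at hcrit
  have hs4 := pow_ne_zero 4 hs
  have hsumU : u 0 + u 1 + u 2 + u 3 + u 4 = t 0 + t 1 := by
    refine mul_left_cancel₀ hs4 ?_
    simp only [mul_add, hu]
    simp [binom, dataVec, fromMoments]
    ring
  have hwtU : u 1 + 2 * u 2 + 3 * u 3 + 4 * u 4 = 4 * t 1 := by
    refine mul_left_cancel₀ hs4 ?_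
    have : (t 0 + t 1) ^ 4 * (u 1 + 2 * u 2 + 3 * u 3 + 4 * u 4) = (t 0 + t 1) ^ 4 * u 1
      + 2 * ((t 0 + t 1) ^ 4 * u 2) + 3 * ((t 0 + t 1) ^ 4 * u 3)
      + 4 * ((t 0 + t 1) ^ 4 * u 4) := by ring
    rw [this]
    simp only [hu]
    simp [binom, dataVec, fromMoments]
    ring
  have hdet' := (mul_eq_zero.1 hdet).resolve_left (by norm_num)
  have h0 := hcrit 0
  have h1 := hcrit 1
  have h2 := hcrit 2
  have h3 := hcrit 3
  have h4 := hcrit 4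
  simp only [binom, hankelGrad, Matrix.cons_val] at h0 h1 h2 h3 h4 hsum
  have hmu : mu = t 0 + t 1 := by
    linear_combination hsumU - h0 - h1 - h2 - h3 - h4 - mu * hsum - 5184 * lam * hdet'
  have hwt : (t 0 + t 1) * (4 * a 1 + 12 * a 2 + 12 * a 3 + 4 * a 4) = 4 * t 1 := by
    rw [← hmu]
    linear_combination hwtU - h1 - 2 * h2 - 3 * h3 - 4 * h4 - 10368 * lam * hdet'
  have hmom : ∀ k, (t 0 + t 1) ^ 4 * a k = fromMoments (t 0) (t 1)
      ![1, 0, toMoments (t 0) (t 1) a 2, toMoments (t 0) (t 1) a 3, toMoments (t 0) (t 1) a 4] k := by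
    intro k
    rw [← fromMoments_toMoments]
    congr 1
    ext j
    fin_cases j
    · simp only [toMoments, Fin.zero_eta, Matrix.cons_val]
      linear_combination hsum
    · simp only [toMoments, Fin.mk_one, Matrix.cons_val]
      linear_combination hwt / 4 - t 1 * hsum
    all_goals rfl
  generalize toMoments (t 0) (t 1) a 2 = P at hmom
  generalize toMoments (t 0) (t 1) a 3 = Q at hmom
  generalize toMoments (t 0) (t 1) a 4 = R at hmom
  refine ⟨P, Q, R, 288 * lam / (t 0 + t 1) ^ 8, fun k => ?_, ?_, fun k => ?_⟩
  · rw [← hmom]; ring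
  · have hPQR : (t 0 + t 1) ^ 6 * (P * R - (Q ^ 2 + P ^ 3)) = 0 := by
      have e0 := hmom 0
      have e1 := hmom 1
      have e2 := hmom 2
      have e3 := hmom 3
      have e4 := hmom 4
      have : (t 0 + t 1) ^ 12 * (a 0 * a 2 * a 4 - a 0 * a 3 ^ 2 - a 1 ^ 2 * a 4
        + 2 * a 1 * a 2 * a 3 - a 2 ^ 3) = ((t 0 + t 1) ^ 4 * a 0) * ((t 0 + t 1) ^ 4 * a 2)
        * ((t 0 + t 1) ^ 4 * a 4) - ((t 0 + t 1) ^ 4 * a 0) * ((t 0 + t 1) ^ 4 * a 3) ^ 2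
        - ((t 0 + t 1) ^ 4 * a 1) ^ 2 * ((t 0 + t 1) ^ 4 * a 4) + 2 * ((t 0 + t 1) ^ 4 * a 1)
        * ((t 0 + t 1) ^ 4 * a 2) * ((t 0 + t 1) ^ 4 * a 3) - ((t 0 + t 1) ^ 4 * a 2) ^ 3 := by
        ring
      rw [hdet', mul_zero, e0, e1, e2, e3, e4] at this
      simp only [fromMoments, Matrix.cons_val] at this
      linear_combination -this
    exact sub_eq_zero.1 ((mul_eq_zero.1 hPQR).resolve_left (pow_ne_zero 6 hs))
  · refine mul_left_cancel₀ (binom_ne_zero k) ?_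
    rw [mul_sub, ← hu, hcrit, ← _root_.funext hmom, hankelGrad_smul, hmu]
    field_simp
    ring

lemma Good.exists_of_mem_critSet {t u z : Fin 5 → ℂ} (ht : Good t)
    (hu : ∀ k, (t 0 + t 1) ^ 4 * u k = binom k * dataVec t k) (hz : z ∈ critSet u) :
    ∃ x y, (∀ k, (t 0 + t 1) ^ 4 * z k = binom k * central (t 0) (t 1) x y k) ∧
      cubic (eqFst t y) x = 0 ∧ cubic (eqSnd t y) x = 0 := by
  have hs := ht.sum_ne
  obtain ⟨P, Q, R, m, hzk, hPQR, hk⟩ := exists_moments_of_mem_critSet hs hu hz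
  have hP : P ≠ 0 := by
    rintro rfl
    obtain rfl : Q = 0 := by
      refine pow_eq_zero_iff (two_ne_zero) |>.1 ?_
      linear_combination -hPQR
    have hR : ∀ k, fromMoments (t 0) (t 1) ![0, 0, t 2, t 3, t 4 - (t 0 + t 1) * R] k
        = m * ((t 0 + t 1) ^ 2 * R) * fromMoments (t 0) (t 1) ![0, 0, (t 0 * t 1) ^ 2 + R,
          3 * (t 0 - t 1) * R, 6 * (t 0 - t 1) ^ 2 * R] k := by
      intro k
      have h := hk k
      fin_cases k <;> simp [dataVec, fromMoments, hankelGrad] at h ⊢ <;> linear_combination h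
    have e2 := eq_mul_of_fromMoments_eq hs hR 2
    have e3 := eq_mul_of_fromMoments_eq hs hR 3
    have e4 := eq_mul_of_fromMoments_eq hs hR 4
    simp only [Matrix.cons_val] at e2 e3 e4
    apply ht.centred_ne
    have h4 : t 4 - 2 * (t 0 - t 1) * t 3 = (t 0 + t 1) * R := by
      linear_combination e4 - 2 * (t 0 - t 1) * e3
    rw [h4, e2, e3]
    ring
  obtain ⟨y, rfl⟩ : ∃ y, Q = P * y := ⟨Q / P, by field_simp⟩
  obtain rfl : R = P * y ^ 2 + P ^ 2 := mul_left_cancel₀ hP (by linear_combination hPQR)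
  have hres : ∀ k, fromMoments (t 0) (t 1)
      ![0, 0, residual t P y 0, residual t P y 1, residual t P y 2] k
      = m * (t 0 + t 1) ^ 2 * P / 2 * fromMoments (t 0) (t 1) ![0, 0, direction (t 0) (t 1) P y 0,
        direction (t 0) (t 1) P y 1, direction (t 0) (t 1) P y 2] k := by
    intro k
    rw [fromMoments_direction, ← dataVec_sub_central]
    have h := hk k
    have h' := hankelGrad_central (t 0) (t 1) P y k
    simp only [central] at h' ⊢
    rw [h, h']
    ring
  have hdir : residual t P y = (m * (t 0 + t 1) ^ 2 * P / 2) • direction (t 0) (t 1) P y := by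
    ext j
    fin_cases j
    · exact eq_mul_of_fromMoments_eq hs hres 2
    · exact eq_mul_of_fromMoments_eq hs hres 3
    · exact eq_mul_of_fromMoments_eq hs hres 4
  refine ⟨P, y, hzk, ?_, ?_⟩
  · rw [cubic_eqFst, hdir, dotProduct_smul, direction, dot_cross_self, smul_zero]
  · rw [cubic_eqSnd, hdir, dotProduct_smul, direction, dot_self_cross, smul_zero]

/-- The candidate critical point attached to a solution `(x, y)` of the two equations. -/
noncomputable def point (t : Fin 5 → ℂ) (x y : ℂ) : Fin 5 → ℂ := fun k =>
  binom k * (central (t 0) (t 1) x y k / (t 0 + t 1) ^ 4)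

lemma Good.point_mem_critSet {t u : Fin 5 → ℂ} (ht : Good t)
    (hu : ∀ k, (t 0 + t 1) ^ 4 * u k = binom k * dataVec t k) {x y : ℂ} (hc : y ≠ -2 * t 1)
    (hb : y ≠ 2 * t 0) (h1 : cubic (eqFst t y) x = 0) (h2 : cubic (eqSnd t y) x = 0) :
    point t x y ∈ critSet u := by
  have hs := ht.sum_ne
  have hx := ht.second_moment_ne_zero h1 h2
  obtain ⟨m, hm⟩ := exists_eq_smul_crossProduct (by rwa [← cubic_eqFst])
    (by rwa [← cubic_eqSnd]) (ht.direction_ne_zero hc hb h1)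
  have hdata : ∀ k, dataVec t k - (t 0 + t 1) * central (t 0) (t 1) x y k
      = 2 * m * (central (t 0) (t 1) x y k * kernelGrad (kernelVec (t 0) (t 1) x y) k) := by
    intro k
    rw [dataVec_sub_central, hm, mul_comm 2 m, mul_assoc, ← fromMoments_direction]
    fin_cases k <;> simp [fromMoments, direction] <;> ring
  refine ⟨fun k => ?_, ?_, ?_, m * (t 0 + t 1) ^ 6 / (144 * x), t 0 + t 1, fun k => ?_⟩
  · refine mul_ne_zero (binom_ne_zero k) (div_ne_zero (fun h0 => ht.dataVec_ne k ?_)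
      (pow_ne_zero 4 hs))
    have h := hdata k
    rw [h0] at h
    linear_combination h
  · refine (eval_hankelDet _).trans ?_
    simp only [central, fromMoments, Matrix.cons_val]
    field_simp
    ring
  · have h := central_mass (t 0) (t 1) x y
    simp only [point, binom, Matrix.cons_val]
    field_simp
    linear_combination h
  · have hgrad : eval (point t x y) (pderiv k hankelDet) = 288 * (hankelGrad
        (fun i => ((t 0 + t 1) ^ 4)⁻¹ * central (t 0) (t 1) x y i) k) := by
      rw [← eval_pderiv_hankelDet]
      congr 2
      ext i
      simp only [point]
      ring
    rw [hgrad, hankelGrad_smul, hankelGrad_central]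
    refine mul_left_cancel₀ (pow_ne_zero 4 hs) ?_
    rw [hu, ← sub_add_cancel (dataVec t k) ((t 0 + t 1) * central (t 0) (t 1) x y k), hdata]
    simp only [point]
    field_simp
    ring

end CriticalPoints

section Count

lemma resolvent_isRoot_of_common_root {t : Fin 5 → ℂ} {x y : ℂ}
    (h1 : cubic (eqFst t y) x = 0) (h2 : cubic (eqSnd t y) x = 0) : (resolvent t).IsRoot y := by
  rw [Polynomial.IsRoot.def, eval_resolvent]
  exact bezoutDet_eq_zero_of_common_root h2 h1

lemma Good.exists_common_root {t : Fin 5 → ℂ} (ht : Good t) {y : ℂ}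
    (hy : (resolvent t).IsRoot y) : ∃ x, cubic (eqFst t y) x = 0 ∧ cubic (eqSnd t y) x = 0 := by
  rw [Polynomial.IsRoot.def, eval_resolvent] at hy
  obtain ⟨x, h2, h1⟩ := exists_common_root_of_bezoutDet_eq_zero
    (by simpa [eqFst, coefFst] using ht.sum_ne) hy
  exact ⟨x, h1, h2⟩

lemma Good.common_root_unique {t : Fin 5 → ℂ} (ht : Good t) {x x' y : ℂ}
    (h1 : cubic (eqFst t y) x = 0) (h2 : cubic (eqSnd t y) x = 0)
    (h1' : cubic (eqFst t y) x' = 0) (h2' : cubic (eqSnd t y) x' = 0) : x = x' := by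
  by_contra hne
  have hder : (resolvent t).derivative.eval y = 0 := by
    refine eval_derivative_bezoutDet_eq_zero _ _ hne ?_ ?_ ?_ ?_ <;>
      simpa only [eval_eqFst, eval_eqSnd]
  have hroot := resolvent_isRoot_of_common_root h1 h2
  obtain ⟨p, q, hpq⟩ := ht.separable
  have h := congrArg (Polynomial.eval y) hpq
  rw [Polynomial.eval_add, Polynomial.eval_mul, Polynomial.eval_mul, hder, hroot.eq_zero,
    Polynomial.eval_one] at h
  simp at h

lemma cubic_neg_two_mul_snd (t : Fin 5 → ℂ) :
    cubic (eqFst t (-2 * t 1)) (-t 1 ^ 2) = 0 ∧ cubic (eqSnd t (-2 * t 1)) (-t 1 ^ 2) = 0 := by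
  constructor <;> simp only [cubic, eqFst, eqSnd, coefFst, coefSnd, Matrix.cons_val] <;> ring

lemma cubic_two_mul_fst (t : Fin 5 → ℂ) :
    cubic (eqFst t (2 * t 0)) (-t 0 ^ 2) = 0 ∧ cubic (eqSnd t (2 * t 0)) (-t 0 ^ 2) = 0 := by
  constructor <;> simp only [cubic, eqFst, eqSnd, coefFst, coefSnd, Matrix.cons_val] <;> ring

/-- Two of the roots of the resolvent correspond to points outside the torus. -/
lemma Good.ne_of_central_ne_zero {t : Fin 5 → ℂ} (ht : Good t) {x y : ℂ}
    (h1 : cubic (eqFst t y) x = 0) (h2 : cubic (eqSnd t y) x = 0)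
    (h : central (t 0) (t 1) x y 2 ≠ 0) : y ≠ -2 * t 1 ∧ y ≠ 2 * t 0 := by
  constructor <;> rintro rfl <;> apply h
  · obtain rfl := ht.common_root_unique h1 h2 (cubic_neg_two_mul_snd t).1 (cubic_neg_two_mul_snd t).2
    simp only [central, fromMoments, Matrix.cons_val]
    ring
  · obtain rfl := ht.common_root_unique h1 h2 (cubic_two_mul_fst t).1 (cubic_two_mul_fst t).2
    simp only [central, fromMoments, Matrix.cons_val]
    ring

lemma point_inj {t : Fin 5 → ℂ} (hs : t 0 + t 1 ≠ 0) {x y x' y' : ℂ} (hx : x ≠ 0)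
    (h : point t x y = point t x' y') : y = y' := by
  have hc : ∀ k, fromMoments (t 0) (t 1) ![1, 0, x, x * y, x * y ^ 2 + x ^ 2] k
      = 1 * fromMoments (t 0) (t 1) ![1, 0, x', x' * y', x' * y' ^ 2 + x' ^ 2] k := by
    intro k
    rw [one_mul]
    exact (div_left_inj' (pow_ne_zero 4 hs)).1 (mul_left_cancel₀ (binom_ne_zero k) (congrFun h k))
  have e2 := eq_mul_of_fromMoments_eq hs hc 2
  have e3 := eq_mul_of_fromMoments_eq hs hc 3
  simp only [Matrix.cons_val, one_mul] at e2 e3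
  subst e2
  exact mul_left_cancel₀ hx e3

lemma Good.card_roots {t : Fin 5 → ℂ} (ht : Good t) :
    (((resolvent t).roots.toFinset.erase (-2 * t 1)).erase (2 * t 0)).card = 12 := by
  have hne : resolvent t ≠ 0 := ht.separable.ne_zero
  have hcard : (resolvent t).roots.toFinset.card = 14 := by
    rw [Multiset.toFinset_card_of_nodup (Polynomial.nodup_roots ht.separable), ← ht.natDegree_eq]
    exact (IsAlgClosed.splits _).natDegree_eq_card_roots.symm
  have hmem : ∀ {x y}, cubic (eqFst t y) x = 0 ∧ cubic (eqSnd t y) x = 0 →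
      y ∈ (resolvent t).roots.toFinset := fun h => by
    rw [Multiset.mem_toFinset, Polynomial.mem_roots hne]
    exact resolvent_isRoot_of_common_root h.1 h.2
  have hdist : 2 * t 0 ≠ -2 * t 1 := fun h => ht.sum_ne (by linear_combination h / 2)
  rw [Finset.card_erase_of_mem (Finset.mem_erase.2 ⟨hdist, hmem (cubic_two_mul_fst t)⟩),
    Finset.card_erase_of_mem (hmem (cubic_neg_two_mul_snd t)), hcard]

theorem Good.ncard_critSet {t u : Fin 5 → ℂ} (ht : Good t)
    (hu : ∀ k, (t 0 + t 1) ^ 4 * u k = binom k * dataVec t k) : (critSet u).ncard = 12 := by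
  have hs := ht.sum_ne
  have hs4 := pow_ne_zero 4 hs
  have hne : resolvent t ≠ 0 := ht.separable.ne_zero
  have hX : ∀ y, ∃ x, (resolvent t).IsRoot y →
      cubic (eqFst t y) x = 0 ∧ cubic (eqSnd t y) x = 0 := by
    intro y
    by_cases hy : (resolvent t).IsRoot y
    · obtain ⟨x, hx⟩ := ht.exists_common_root hy
      exact ⟨x, fun _ => hx⟩
    · exact ⟨0, fun h => absurd h hy⟩
  choose ξ hξ using hX
  have hroots : ∀ y, y ∈ ((resolvent t).roots.toFinset.erase (-2 * t 1)).erase (2 * t 0) ↔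
      y ≠ 2 * t 0 ∧ y ≠ -2 * t 1 ∧ (resolvent t).IsRoot y := by
    intro y
    rw [Finset.mem_erase, Finset.mem_erase, Multiset.mem_toFinset, Polynomial.mem_roots hne]
  have himage : critSet u = (fun y => point t (ξ y) y) ''
      (((resolvent t).roots.toFinset.erase (-2 * t 1)).erase (2 * t 0) : Finset ℂ) := by
    ext z
    constructor
    · intro hz
      obtain ⟨x, y, hxy, h1, h2⟩ := ht.exists_of_mem_critSet hu hz
      have hroot := resolvent_isRoot_of_common_root h1 h2
      have hcen : central (t 0) (t 1) x y 2 ≠ 0 := fun h => by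
        have h' := hxy 2
        rw [h, mul_zero] at h'
        exact mul_ne_zero hs4 (hz.1 2) h'
      obtain ⟨hc, hb⟩ := ht.ne_of_central_ne_zero h1 h2 hcen
      refine ⟨y, (hroots y).2 ⟨hb, hc, hroot⟩, ?_⟩
      obtain rfl := ht.common_root_unique h1 h2 (hξ y hroot).1 (hξ y hroot).2
      ext k
      simp only [point]
      rw [← mul_div_assoc, ← hxy, mul_div_cancel_left₀ _ hs4]
    · rintro ⟨y, hy, rfl⟩
      obtain ⟨hb, hc, hroot⟩ := (hroots y).1 hy
      exact ht.point_mem_critSet hu hc hb (hξ y hroot).1 (hξ y hroot).2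
  rw [himage, Set.InjOn.ncard_image, Set.ncard_coe_finset, ht.card_roots]
  intro y hy y' _ h
  obtain ⟨-, -, hroot⟩ := (hroots y).1 hy
  exact point_inj hs (ht.second_moment_ne_zero (hξ y hroot).1 (hξ y hroot).2) h

end Count

section GenericGood

lemma generic_dataVec_ne (k : Fin 5) : Generic fun t => dataVec t k ≠ 0 := by
  have h : ∀ t : Fin 5 → ℂ,
      eval t (dataVec (X : Fin 5 → MvPolynomial (Fin 5) ℂ) k) = dataVec t k := by
    intro t
    fin_cases k <;> simp [dataVec, fromMoments]
  refine (generic_eval_ne_zero (dataVec X k) ![1, 0, 1, 0, 1] ?_).mono fun t ht => by rwa [h] at ht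
  rw [h]
  fin_cases k <;> simp only [dataVec, fromMoments, Matrix.cons_val, Fin.zero_eta, Fin.mk_one,
    Fin.reduceFinMk] <;> norm_num

lemma generic_product_ne : Generic fun t => cubic (eqFst t (t 0 - t 1)) (t 0 * t 1) ≠ 0 := by
  have h : ∀ t : Fin 5 → ℂ,
      eval t (cubic (eqFst (X : Fin 5 → MvPolynomial (Fin 5) ℂ) (X 0 - X 1)) (X 0 * X 1))
        = cubic (eqFst t (t 0 - t 1)) (t 0 * t 1) := by
    intro t
    simp [cubic, map_eqFst]
  refine (generic_eval_ne_zero _ ![1, 0, 1, 0, 1] ?_).mono fun t ht => by rwa [h] at ht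
  rw [h]
  simp only [cubic, eqFst, coefFst, Matrix.cons_val]
  norm_num

lemma generic_alternating_ne : Generic fun t =>
    alternatingObstruction (t 0 + t 1) (t 0 * t 1) (t 0 - t 1) (t 2) (t 3) (t 4) ≠ 0 := by
  have h : ∀ t : Fin 5 → ℂ, eval t (alternatingObstruction
      (X 0 + X 1 : MvPolynomial (Fin 5) ℂ) (X 0 * X 1) (X 0 - X 1) (X 2) (X 3) (X 4))
        = alternatingObstruction (t 0 + t 1) (t 0 * t 1) (t 0 - t 1) (t 2) (t 3) (t 4) := by
    intro t
    simp [alternatingObstruction]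
  refine (generic_eval_ne_zero _ ![1, 0, 1, 0, 1] ?_).mono fun t ht => by rwa [h] at ht
  rw [h]
  simp only [alternatingObstruction, Matrix.cons_val]
  norm_num

lemma generic_sum_ne : Generic fun t => t 0 + t 1 ≠ 0 :=
  (generic_eval_ne_zero (X 0 + X 1) ![1, 0, 1, 0, 1] (by simp)).mono fun t ht => by simpa using ht

lemma generic_good : Generic Good := by
  have hfst : Generic fun t => t 0 ≠ 0 :=
    (generic_eval_ne_zero (X 0) ![1, 0, 1, 0, 1] (by simp)).mono fun t ht => by simpa using ht
  have hsnd : Generic fun t => t 1 ≠ 0 :=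
    (generic_eval_ne_zero (X 1) ![0, 1, 1, 0, 1] (by simp)).mono fun t ht => by simpa using ht
  have hdiff : Generic fun t => t 0 - t 1 ≠ 0 :=
    (generic_eval_ne_zero (X 0 - X 1) ![1, 0, 1, 0, 1] (by simp)).mono fun t ht => by
      simpa using ht
  have hdeg : Generic fun t => 2 * t 3 ^ 2 - 3 * t 2 * t 4 ≠ 0 :=
    (generic_eval_ne_zero (2 * X 3 ^ 2 - 3 * X 2 * X 4) ![1, 0, 1, 0, 1] (by simp)).mono
      fun t ht => by simpa using ht
  have hcen : Generic fun t => 3 * (t 0 - t 1) * t 2 * (t 4 - 2 * (t 0 - t 1) * t 3)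
      - t 3 * ((t 0 + t 1) * (t 0 * t 1) ^ 2 + (t 4 - 2 * (t 0 - t 1) * t 3)) ≠ 0 :=
    (generic_eval_ne_zero (3 * (X 0 - X 1) * X 2 * (X 4 - 2 * (X 0 - X 1) * X 3)
      - X 3 * ((X 0 + X 1) * (X 0 * X 1) ^ 2 + (X 4 - 2 * (X 0 - X 1) * X 3)))
      ![1, 0, 1, 0, 1] (by simp)).mono fun t ht => by simpa using ht
  have hdata := ((((generic_dataVec_ne 0).and (generic_dataVec_ne 1)).and
    (generic_dataVec_ne 2)).and (generic_dataVec_ne 3)).and (generic_dataVec_ne 4)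
  refine ((generic_sum_ne.and (hfst.and (hsnd.and (hdiff.and (hdata.and (hdeg.and hcen)))))).and
    (generic_product_ne.and (generic_alternating_ne.and
      (generic_natDegree_resolvent.and generic_separable_resolvent)))).mono ?_
  rintro t ⟨⟨h1, h2, h3, h4, ⟨⟨⟨⟨d0, d1⟩, d2⟩, d3⟩, d4⟩, h5, h6⟩, h7, h8, h9, h10⟩
  refine ⟨h1, h2, h3, h4, fun k => ?_, h5, h6, h7, h8, h9, h10⟩
  fin_cases k
  exacts [d0, d1, d2, d3, d4]

end GenericGood

section Parameters

/-- The parameters `(b, c, α, β, γ)` of a data vector, as polynomials in its coordinates: the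
marginals and the higher central moments. -/
noncomputable def parameter : Fin 5 → MvPolynomial (Fin 5) ℂ :=
  let a : Fin 5 → MvPolynomial (Fin 5) ℂ := ![X 0, C (1 / 4) * X 1, C (1 / 6) * X 2,
    C (1 / 4) * X 3, X 4]
  let b := a 0 + 3 * a 1 + 3 * a 2 + a 3
  let c := a 1 + 3 * a 2 + 3 * a 3 + a 4
  ![b, c, toMoments b c a 2, toMoments b c a 3, toMoments b c a 4]

lemma eval_parameter (a : Fin 5 → ℂ) (k : Fin 5) :
    eval (fun i => binom i * a i) (parameter k)
      = ![a 0 + 3 * a 1 + 3 * a 2 + a 3, a 1 + 3 * a 2 + 3 * a 3 + a 4,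
        toMoments (a 0 + 3 * a 1 + 3 * a 2 + a 3) (a 1 + 3 * a 2 + 3 * a 3 + a 4) a 2,
        toMoments (a 0 + 3 * a 1 + 3 * a 2 + a 3) (a 1 + 3 * a 2 + 3 * a 3 + a 4) a 3,
        toMoments (a 0 + 3 * a 1 + 3 * a 2 + a 3) (a 1 + 3 * a 2 + 3 * a 3 + a 4) a 4] k := by
  fin_cases k <;> simp [parameter, toMoments, binom]

lemma dataVec_parameter (u : Fin 5 → ℂ) (k : Fin 5) :
    (eval u (parameter 0) + eval u (parameter 1)) ^ 4 * u k
      = binom k * dataVec (fun i => eval u (parameter i)) k := by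
  obtain ⟨a, rfl⟩ : ∃ a : Fin 5 → ℂ, u = fun k => binom k * a k :=
    ⟨fun k => u k / binom k, _root_.funext fun k => by
      rw [mul_div_cancel₀ _ (binom_ne_zero k)]⟩
  simp only [dataVec, eval_parameter, Matrix.cons_val]
  rw [mul_left_comm, ← fromMoments_toMoments]
  congr 3
  ext j
  fin_cases j <;> simp [toMoments] <;> ring

lemma exists_eval_parameter_eq {t : Fin 5 → ℂ} (hs : t 0 + t 1 ≠ 0) :
    ∃ u, ∀ i, eval u (parameter i) = t i := by
  have hs4 := pow_ne_zero 4 hs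
  refine ⟨fun k => binom k * (dataVec t k / (t 0 + t 1) ^ 4), fun i => ?_⟩
  rw [eval_parameter]
  have hb : dataVec t 0 / (t 0 + t 1) ^ 4 + 3 * (dataVec t 1 / (t 0 + t 1) ^ 4)
      + 3 * (dataVec t 2 / (t 0 + t 1) ^ 4) + dataVec t 3 / (t 0 + t 1) ^ 4 = t 0 := by
    simp only [dataVec, fromMoments, Matrix.cons_val]
    field_simp
    ring
  have hc : dataVec t 1 / (t 0 + t 1) ^ 4 + 3 * (dataVec t 2 / (t 0 + t 1) ^ 4)
      + 3 * (dataVec t 3 / (t 0 + t 1) ^ 4) + dataVec t 4 / (t 0 + t 1) ^ 4 = t 1 := by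
    simp only [dataVec, fromMoments, Matrix.cons_val]
    field_simp
    ring
  have hm : ∀ j, toMoments (t 0) (t 1) (fun k => dataVec t k / (t 0 + t 1) ^ 4) j
      = (![t 0 + t 1, 0, t 2, t 3, t 4] : Fin 5 → ℂ) j := by
    intro j
    refine mul_left_cancel₀ hs4 ?_
    refine Eq.trans ?_ (toMoments_fromMoments (t 0) (t 1) _ j)
    change _ = toMoments (t 0) (t 1) (dataVec t) j
    fin_cases j <;> simp only [toMoments, Matrix.cons_val, Fin.zero_eta, Fin.mk_one,
      Fin.reduceFinMk] <;> field_simp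
  rw [hb, hc, hm, hm, hm]
  fin_cases i <;> rfl

end Parameters

end HankelML

/-- **The ML degree of the Hankel determinantal hypersurface sliced by
`z₁ + ⋯ + z₅ = 1` is `r₀ = 12`**: for generic `u ∈ ℂ⁵` there are exactly `12`
ML-critical points of the pair `(hankelDet, z₁ + ⋯ + z₅ − 1)` on the torus. -/
theorem hankel_ml_degree :
    ∃ g : MvPolynomial (Fin 5) ℂ, g ≠ 0 ∧
      ∀ u : Fin 5 → ℂ, eval u g ≠ 0 →
        {z : Fin 5 → ℂ | (∀ i, z i ≠ 0) ∧ eval z hankelDet = 0 ∧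
            z 0 + z 1 + z 2 + z 3 + z 4 - 1 = 0 ∧
            ∃ lam mu : ℂ, ∀ i,
              u i = lam * z i * eval z (pderiv i hankelDet) + mu * z i}.ncard = 12 := by
  refine HankelML.Generic.mono (HankelML.generic_good.comap HankelML.parameter
    HankelML.generic_sum_ne fun t ht => HankelML.exists_eval_parameter_eq ht) fun u hu => ?_
  exact hu.ncard_critSet (HankelML.dataVec_parameter u)
end

section
/- Let h ∈ ℂ[z₁,…,z₅] be the determinant of the Hankel matrix [[12z₁, 3z₂, 2z₃], [3z₂, 2z₃, 3z₄], [2z₃, 3z₄, 12z₅]]. For generic u ∈ ℂ⁵ there is no point z ∈ (ℂ*)⁵ with h(z) = 0, z₁ = 1, and λ, μ ∈ ℂ satisfying u₁ = λ·z₁·(∂h/∂z₁)(z) + μ·z₁ and u_i = λ·z_i·(∂h/∂z_i)(z) for i = 2,…,5. (The ML degree of the Hankel determinantal hypersurface sliced by the affine constraint z₁ = 1 is r₀ = 0.) -/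
open MvPolynomial

/-- Euler's identity for `hankelDet`, which is weighted homogeneous of degree `6` when `X i` has
weight `i`. -/
lemma hankelDet_weighted_euler (z : Fin 5 → ℂ) :
    z 1 * eval z (pderiv 1 hankelDet) + 2 * (z 2 * eval z (pderiv 2 hankelDet)) +
      3 * (z 3 * eval z (pderiv 3 hankelDet)) + 4 * (z 4 * eval z (pderiv 4 hankelDet)) =
    6 * eval z hankelDet := by
  have hC (n : ℕ) [n.AtLeastTwo] (i : Fin 5) :
      pderiv i (OfNat.ofNat n : MvPolynomial (Fin 5) ℂ) = 0 :=
    (pderiv i).map_natCast n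
  simp [hankelDet, Matrix.det_fin_three, pderiv_X, hC]
  ring

/-- **The ML degree of the Hankel determinantal hypersurface sliced by the affine
constraint `z₁ = 1` is `r₀ = 0`**: for generic `u ∈ ℂ⁵` there is no ML-critical point
of the pair `(hankelDet, z₁ − 1)` on the torus. -/
theorem hankel_ml_degree_affine_slice_zero :
    ∃ g : MvPolynomial (Fin 5) ℂ, g ≠ 0 ∧
      ∀ u : Fin 5 → ℂ, eval u g ≠ 0 →
        ¬ ∃ z : Fin 5 → ℂ, (∀ i, z i ≠ 0) ∧ eval z hankelDet = 0 ∧ z 0 = 1 ∧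
            ∃ lam mu : ℂ,
              u 0 = lam * z 0 * eval z (pderiv 0 hankelDet) + mu * z 0 ∧
              ∀ i : Fin 5, i ≠ 0 → u i = lam * z i * eval z (pderiv i hankelDet) := by
  refine ⟨X 1 + 2 * X 2 + 3 * X 3 + 4 * X 4, fun h => ?_, ?_⟩
  · simpa using congrArg (eval (Pi.single 1 1 : Fin 5 → ℂ)) h
  · rintro u hu ⟨z, -, hz, -, lam, mu, -, h⟩
    refine hu ?_
    simp only [map_add, map_mul, map_ofNat, eval_X]
    rw [h 1 (by decide), h 2 (by decide), h 3 (by decide), h 4 (by decide)]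
    linear_combination lam * hankelDet_weighted_euler z + 6 * lam * hz
end
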